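/- The supremum, over all functions f : ℕ → ℂ with ‖f‖∞ ≤ 1, of | (1/N) ∑_{n=1}^N f(Ω(n)) − E^{2bin}_{n≤⌊log log N⌋} f(n) | tends to 0 as N → ∞. -/

import Mathlib

open Filter Finset

/-- Discrete derivative: `ΔW(N) = W(N) - W(N-1)` for `N ≥ 2`, and `ΔW(1) = W(1)`. -/
noncomputable def dd (W : ℕ → ℝ) (N : ℕ) : ℝ := if 2 ≤ N then W N - W (N - 1) else W 1

/-- Weighted average `E^W_{n ≤ N} f(n) = (1/W(N)) ∑_{n=1}^N ΔW(n) f(n)`. -/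
noncomputable def wAvg (W : ℕ → ℝ) (f : ℕ → ℂ) (N : ℕ) : ℂ :=
  (1 / (W N : ℂ)) * ∑ n ∈ Finset.Icc 1 N, (dd W n : ℂ) * f n

/-- Cesàro average `E_{n ≤ N} f(n) = (1/N) ∑_{n=1}^N f(n)`. -/
noncomputable def cesaro (f : ℕ → ℂ) (N : ℕ) : ℂ :=
  (1 / (N : ℂ)) * ∑ n ∈ Finset.Icc 1 N, f n

/-- Parity-neutral binomial mean. -/
noncomputable def e2bin (f : ℕ → ℂ) (N : ℕ) : ℂ :=
  (1 / 2 ^ (N + 1) : ℂ) * ∑ n ∈ Finset.Icc 1 (2 * N), (Nat.choose N (n / 2) : ℂ) * f n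

/-- Binomial mean. -/
noncomputable def ebin (f : ℕ → ℂ) (N : ℕ) : ℂ :=
  (1 / 2 ^ N : ℂ) * ∑ n ∈ Finset.Icc 1 N, (Nat.choose N n : ℂ) * f n

/-- The class 𝒲: eventually non-decreasing nonnegative functions tending to ∞. -/
def memW (W : ℕ → ℝ) : Prop :=
  (∀ n, 0 ≤ W n) ∧ (∃ N₀ : ℕ, ∀ m n : ℕ, N₀ ≤ m → m ≤ n → W m ≤ W n) ∧
    Tendsto W atTop atTop

/-- The class 𝒲*: members of 𝒲 for which `N·Δ²W(N)/ΔW(N)` converges in `ℝ ∪ {±∞}`. -/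
def memWstar (W : ℕ → ℝ) : Prop :=
  memW W ∧ ∃ l : EReal,
    Tendsto (fun N : ℕ => (((N : ℝ) * dd (dd W) N / dd W N : ℝ) : EReal)) atTop (nhds l)

/-- The class ℒ: members of 𝒲 (with values in ℕ) whose discrete derivative is
eventually in {0,1}. -/
def memL (L : ℕ → ℕ) : Prop :=
  memW (fun n => (L n : ℝ)) ∧
    ∃ N₀ : ℕ, ∀ n : ℕ, N₀ ≤ n → L n = L (n - 1) ∨ L n = L (n - 1) + 1

/-- Gaussian probability density with mean μ and standard deviation σ. -/
noncomputable def gauss (x μ σ : ℝ) : ℝ :=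
  (1 / (σ * Real.sqrt (2 * Real.pi))) * Real.exp (-(x - μ) ^ 2 / (2 * σ ^ 2))

/-- The Gaussian condition \eqref{gaussian_condition}. -/
def gaussCond (ϑ : ℕ → ℕ) (L : ℕ → ℕ) : Prop :=
  Tendsto (fun N : ℕ => ∑' k : ℕ,
      |(((Finset.Icc 1 N).filter (fun n => ϑ n = k + 1)).card : ℝ) / N -
        gauss (k + 1 : ℝ) (L N) (Real.sqrt (L N))|) atTop (nhds 0)

/-- Ω(n): number of prime factors with multiplicity. -/
def bigOmega (n : ℕ) : ℕ := n.primeFactorsList.length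

/-- ω(n): number of distinct prime factors. -/
def smallOmega (n : ℕ) : ℕ := n.primeFactors.card

/-- Uniform distribution mod 1. -/
def udMod1 (x : ℕ → ℝ) : Prop :=
  ∀ a b : ℝ, 0 ≤ a → a < b → b ≤ 1 →
    Tendsto (fun N : ℕ =>
        (((Finset.Icc 1 N).filter
            (fun n => a ≤ Int.fract (x n) ∧ Int.fract (x n) < b)).card : ℝ) / N)
      atTop (nhds (b - a))

/-- The Mellin-type integral `∫₁^∞ {t} t^{-(s+1)} dt` of the fractional part. -/
noncomputable def fractMellin (s : ℂ) : ℂ :=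
  ∫ t in Set.Ioi (1 : ℝ), ((Int.fract t : ℝ) : ℂ) * (t : ℂ) ^ (-(s + 1))

lemma integrableOn_fract_mul_cpow {s : ℂ} (hs : 0 < s.re) :
    MeasureTheory.IntegrableOn (fun t : ℝ => ((Int.fract t : ℝ) : ℂ) * (t : ℂ) ^ (-(s + 1)))
      (Set.Ioi 1) := by
  have h := integrableOn_Ioi_cpow_of_lt (a := -(s + 1)) (c := 1) (by simp; linarith) one_pos
  refine MeasureTheory.Integrable.bdd_mul (c := 1) h ?_ ?_
  · exact (Complex.measurable_ofReal.comp measurable_fract).aestronglyMeasurable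
  · refine Eventually.of_forall fun t => ?_
    rw [Complex.norm_real, Real.norm_eq_abs, abs_of_nonneg (Int.fract_nonneg t)]
    exact (Int.fract_lt_one t).le

lemma riemannZeta₀_eq_one_sub_mul_fractMellin {s : ℂ} (hs : 1 < s.re) :
    riemannZeta₀ s = 1 - s * fractMellin s := by
  have hs1 : s ≠ 1 := by rintro rfl; simp at hs
  have hs0 : s ≠ 0 := by rintro rfl; simp at hs; linarith
  have h1 := LSeries_eq_mul_integral' (1 : ℕ → ℂ) (r := 1) zero_le_one hs (by
    simp only [Pi.one_apply, norm_one, sum_const, Nat.card_Icc, add_tsub_cancel_right,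
      nsmul_eq_mul, mul_one, Real.rpow_one]
    exact Asymptotics.isBigO_refl _ _)
  rw [LSeries_one_eq_riemannZeta hs] at h1
  have h2 : ∫ t in Set.Ioi (1 : ℝ), (∑ k ∈ Icc 1 ⌊t⌋₊, (1 : ℕ → ℂ) k) * (t : ℂ) ^ (-(s + 1))
      = (∫ t in Set.Ioi (1 : ℝ), (t : ℂ) ^ (-s)) - fractMellin s := by
    rw [fractMellin, ← MeasureTheory.integral_sub
      (integrableOn_Ioi_cpow_of_lt (by simp; linarith) one_pos)
      (integrableOn_fract_mul_cpow (by linarith))]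
    refine MeasureTheory.setIntegral_congr_fun measurableSet_Ioi fun t ht => ?_
    have ht0 : (0 : ℝ) < t := lt_trans one_pos ht
    have hfl : ((⌊t⌋₊ : ℕ) : ℂ) = (t : ℂ) - ((Int.fract t : ℝ) : ℂ) := by
      have : ((⌊t⌋₊ : ℕ) : ℝ) = t - Int.fract t := by
        rw [natCast_floor_eq_intCast_floor ht0.le, Int.self_sub_fract]
      exact_mod_cast congrArg (fun r : ℝ => (r : ℂ)) this
    simp only [Pi.one_apply, sum_const, Nat.card_Icc, add_tsub_cancel_right, nsmul_eq_mul, mul_one]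
    have h3 : (t : ℂ) ^ (-s) = t * (t : ℂ) ^ (-(s + 1)) := by
      rw [show -s = 1 + -(s + 1) by ring, Complex.cpow_add _ _ (by exact_mod_cast ht0.ne'),
        Complex.cpow_one]
    rw [hfl, h3]; ring
  rw [h2, integral_Ioi_cpow_of_lt (by simp; linarith) one_pos] at h1
  rw [riemannZeta₀, if_neg hs1, h1]
  have : s - 1 ≠ 0 := sub_ne_zero.2 hs1
  have h5 : -s + 1 ≠ 0 := by intro h; apply this; linear_combination -h
  simp only [Complex.ofReal_one, Complex.one_cpow]
  field_simp
  ring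

lemma norm_fractMellin_le {s : ℂ} (hs : 1 < s.re) : ‖fractMellin s‖ ≤ 1 := by
  have h := integral_Ioi_rpow_of_lt (a := -2) (c := 1) (by norm_num) one_pos
  refine (MeasureTheory.norm_integral_le_of_norm_le
    (integrableOn_Ioi_rpow_of_lt (a := -2) (by norm_num) one_pos) ?_).trans (h.trans_le ?_)
  · refine (MeasureTheory.ae_restrict_iff' measurableSet_Ioi).2 (Eventually.of_forall fun t ht => ?_)
    have ht1 : (1 : ℝ) < t := ht
    rw [norm_mul, Complex.norm_real, Complex.norm_cpow_eq_rpow_re_of_pos (by linarith),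
      Real.norm_eq_abs, abs_of_nonneg (Int.fract_nonneg t)]
    calc _ ≤ 1 * t ^ (-2 : ℝ) := by
          refine mul_le_mul (Int.fract_lt_one t).le ?_ (by positivity) zero_le_one
          exact Real.rpow_le_rpow_of_exponent_le ht1.le (by simp; linarith)
      _ = _ := one_mul _
  · norm_num

lemma norm_exp_sub_exp_le {a b : ℂ} (ha : a.re ≤ 0) (hb : b.re ≤ 0) :
    ‖Complex.exp a - Complex.exp b‖ ≤ ‖a - b‖ := by
  have := (convex_halfSpace_re_le 0).norm_image_sub_le_of_norm_deriv_le (f := Complex.exp) (C := 1)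
    (fun x _ => Complex.differentiableAt_exp) (fun x hx => by
      rw [Complex.deriv_exp, Complex.norm_exp]; exact Real.exp_le_one_iff.2 hx)
    (show b ∈ {c : ℂ | c.re ≤ 0} from hb) (show a ∈ {c : ℂ | c.re ≤ 0} from ha)
  simpa using this

lemma norm_cpow_sub_cpow_le {t : ℝ} (ht : 1 < t) {s w : ℂ} (hs : 1 < s.re) (hw : 1 < w.re) :
    ‖(t : ℂ) ^ (-(s + 1)) - (t : ℂ) ^ (-(w + 1))‖ ≤ ‖s - w‖ * (2 * t ^ (-(3 / 2) : ℝ)) := by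
  have ht0 : (t : ℂ) ≠ 0 := by exact_mod_cast (by linarith : t ≠ 0)
  have hL : 0 ≤ Real.log t := Real.log_nonneg ht.le
  have key : ∀ u : ℂ, (t : ℂ) ^ (-(u + 1)) =
      (t : ℂ) ^ (-2 : ℂ) * Complex.exp (-(Real.log t : ℂ) * (u - 1)) := fun u => by
    rw [show -(u + 1) = -2 + -(u - 1) by ring, Complex.cpow_add _ _ ht0]
    congr 1
    rw [Complex.cpow_def_of_ne_zero ht0, ← Complex.ofReal_log (by linarith)]
    ring_nf
  rw [key s, key w, ← mul_sub, norm_mul, Complex.norm_cpow_eq_rpow_re_of_pos (by linarith)]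
  have h1 : ‖Complex.exp (-(Real.log t : ℂ) * (s - 1)) - Complex.exp (-(Real.log t : ℂ) * (w - 1))‖
      ≤ Real.log t * ‖s - w‖ := by
    refine (norm_exp_sub_exp_le ?_ ?_).trans ?_
    · simp; nlinarith
    · simp; nlinarith
    · rw [← mul_sub, norm_mul, norm_neg, Complex.norm_real, Real.norm_eq_abs, abs_of_nonneg hL]
      simp
  have h2 : Real.log t ≤ 2 * t ^ (1 / 2 : ℝ) := by
    have := Real.log_le_rpow_div (x := t) (by linarith) (show (0 : ℝ) < 1 / 2 by norm_num)
    linarith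
  have h3 : t ^ (-2 : ℝ) * t ^ (1 / 2 : ℝ) = t ^ (-(3 / 2) : ℝ) := by
    rw [← Real.rpow_add (by linarith)]; norm_num
  have h4 : (0 : ℝ) ≤ t ^ (-2 : ℝ) := by positivity
  calc _ ≤ t ^ (-2 : ℝ) * (2 * t ^ (1 / 2 : ℝ) * ‖s - w‖) := by
        have : ((-2 : ℂ)).re = -2 := by simp
        rw [this]
        gcongr
        exact h1.trans (by gcongr)
    _ = _ := by rw [← h3]; ring

lemma norm_fractMellin_sub_le {s w : ℂ} (hs : 1 < s.re) (hw : 1 < w.re) :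
    ‖fractMellin s - fractMellin w‖ ≤ 4 * ‖s - w‖ := by
  rw [fractMellin, fractMellin, ← MeasureTheory.integral_sub
    (integrableOn_fract_mul_cpow (by linarith)) (integrableOn_fract_mul_cpow (by linarith))]
  have hi := (integrableOn_Ioi_rpow_of_lt (a := -(3 / 2)) (c := 1) (by norm_num) one_pos)
  refine (MeasureTheory.norm_integral_le_of_norm_le
    ((hi.const_mul 2).const_mul ‖s - w‖) ?_).trans ?_
  · refine (MeasureTheory.ae_restrict_iff' measurableSet_Ioi).2 (Eventually.of_forall fun t ht => ?_)
    have ht1 : (1 : ℝ) < t := ht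
    rw [← mul_sub, norm_mul, Complex.norm_real, Real.norm_eq_abs,
      abs_of_nonneg (Int.fract_nonneg t)]
    refine (mul_le_of_le_one_left (norm_nonneg _) (Int.fract_lt_one t).le).trans ?_
    exact norm_cpow_sub_cpow_le ht1 hs hw
  · rw [MeasureTheory.integral_const_mul, MeasureTheory.integral_const_mul,
      integral_Ioi_rpow_of_lt (by norm_num) one_pos]
    norm_num
    linarith

lemma norm_riemannZeta₀_le {s : ℂ} (hs : 1 < s.re) : ‖riemannZeta₀ s‖ ≤ 1 + ‖s‖ := by
  rw [riemannZeta₀_eq_one_sub_mul_fractMellin hs]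
  refine (norm_sub_le _ _).trans ?_
  rw [norm_one, norm_mul]
  have := norm_fractMellin_le hs
  nlinarith [norm_nonneg s]

lemma norm_deriv_riemannZeta₀_le {s : ℂ} (hs : 1 < s.re) :
    ‖deriv riemannZeta₀ s‖ ≤ 2 + 4 * ‖s‖ := by
  have hev : ∀ᶠ w in nhds s, 1 < w.re :=
    (isOpen_lt continuous_const Complex.continuous_re).mem_nhds hs
  have hball : ∀ᶠ w in nhds s, ‖w - s‖ < 1 / 4 := by
    simp only [← dist_eq_norm]
    exact Metric.ball_mem_nhds s (by norm_num)
  refine (differentiable_riemannZeta₀ s).hasDerivAt.le_of_lip' (by positivity) ?_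
  filter_upwards [hev, hball] with w hw hws
  rw [riemannZeta₀_eq_one_sub_mul_fractMellin hs, riemannZeta₀_eq_one_sub_mul_fractMellin hw]
  have h1 : (1 - w * fractMellin w) - (1 - s * fractMellin s)
      = -((w - s) * fractMellin w + s * (fractMellin w - fractMellin s)) := by ring
  rw [h1, norm_neg]
  refine (norm_add_le _ _).trans ?_
  rw [norm_mul, norm_mul]
  have h2 := norm_fractMellin_le hw
  have h3 := norm_fractMellin_sub_le hw hs
  nlinarith [norm_nonneg s, norm_nonneg (w - s), mul_le_mul_of_nonneg_left h3 (norm_nonneg s),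
    mul_le_mul_of_nonneg_left h2 (norm_nonneg (w - s))]

lemma one_le_norm_riemannZeta_product {x : ℝ} (hx : 0 < x) (y : ℝ) :
    1 ≤ ‖riemannZeta (1 + x)‖ ^ 3 * ‖riemannZeta (1 + x + Complex.I * y)‖ ^ 4 *
      ‖riemannZeta (1 + x + 2 * Complex.I * y)‖ := by
  have := DirichletCharacter.norm_LFunction_product_ge_one (1 : DirichletCharacter ℂ 1) hx y
  rw [DirichletCharacter.LFunctionTrivChar, DirichletCharacter.LFunction_modOne_eq,
    DirichletCharacter.LFunction_modOne_eq, norm_mul, norm_mul, norm_pow, norm_pow] at this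
  exact this

lemma norm_riemannZeta_le {s : ℂ} (hs : 1 < s.re) : ‖riemannZeta s‖ ≤ ‖s - 1‖⁻¹ + 1 + ‖s‖ := by
  have hs1 : s ≠ 1 := by rintro rfl; simp at hs
  rw [riemannZeta_eq_inv_sub_add hs1]
  refine (norm_add_le _ _).trans ?_
  rw [norm_inv]
  linarith [norm_riemannZeta₀_le hs]

lemma norm_deriv_riemannZeta_le {s : ℂ} (hs : 1 < s.re) :
    ‖deriv riemannZeta s‖ ≤ (‖s - 1‖⁻¹) ^ 2 + 2 + 4 * ‖s‖ := by
  have hs1 : s ≠ 1 := by rintro rfl; simp at hs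
  rw [deriv_riemannZeta_eq_neg_inv_sub_sq_add hs1]
  refine (norm_add_le _ _).trans ?_
  rw [norm_neg, norm_pow, norm_inv]
  linarith [norm_deriv_riemannZeta₀_le hs]

/-- The quantitative `3-4-1` bound to the right of the line `Re s = 1`. -/
lemma pow_div_le_norm_riemannZeta_pow {x y : ℝ} (hx : 0 < x) (hx1 : x ≤ 1) (hy : 1 ≤ |y|) :
    x ^ 3 / (768 * |y|) ≤ ‖riemannZeta (1 + x + Complex.I * y)‖ ^ 4 := by
  have h := one_le_norm_riemannZeta_product hx y
  have h1 : ‖riemannZeta (1 + x)‖ ≤ 4 / x := by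
    refine (norm_riemannZeta_le (by simp [hx])).trans ?_
    have e1 : ‖(1 + x - 1 : ℂ)‖ = x := by
      rw [add_sub_cancel_left, Complex.norm_real, Real.norm_of_nonneg hx.le]
    have e2 : ‖(1 + x : ℂ)‖ ≤ 2 := by
      refine (norm_add_le _ _).trans ?_
      rw [Complex.norm_real, Real.norm_of_nonneg hx.le]; simp; linarith
    rw [e1]
    have : 1 ≤ 1 / x := (one_le_div hx).2 hx1
    have e3 : 4 / x = 4 * (1 / x) := by ring
    rw [e3, ← one_div]; linarith
  have h2 : ‖riemannZeta (1 + x + 2 * Complex.I * y)‖ ≤ 12 * |y| := by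
    refine (norm_riemannZeta_le (by simp [hx])).trans ?_
    have e1 : 1 ≤ ‖(1 + x + 2 * Complex.I * y - 1 : ℂ)‖ := by
      refine le_trans ?_ (Complex.abs_im_le_norm _)
      simp [abs_mul]; linarith
    have e2 : ‖(1 + x + 2 * Complex.I * y : ℂ)‖ ≤ 2 + 2 * |y| := by
      refine (norm_add_le _ _).trans ?_
      have := norm_add_le (1 : ℂ) x
      rw [Complex.norm_real, Real.norm_of_nonneg hx.le] at this
      simp at this ⊢
      linarith
    have := inv_le_one_of_one_le₀ e1
    linarith
  set A := ‖riemannZeta (1 + x)‖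
  set B := ‖riemannZeta (1 + x + Complex.I * y)‖ ^ 4
  set D := ‖riemannZeta (1 + x + 2 * Complex.I * y)‖
  have hB : 0 ≤ B := by positivity
  have h3 : A ^ 3 * B * D ≤ (4 / x) ^ 3 * B * (12 * |y|) := by
    gcongr
  have h4 : (4 / x) ^ 3 * B * (12 * |y|) = B * (768 * |y|) / x ^ 3 := by
    field_simp; ring
  rw [h4] at h3
  have h5 := h.trans h3
  rw [le_div_iff₀ (by positivity)] at h5
  rw [div_le_iff₀ (by positivity)]
  linarith

/-- A polynomial lower bound for `ζ` in the strip `1 < Re s ≤ 2`, `|Im s| ≥ 1`. -/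
lemma exists_div_pow_le_norm_riemannZeta : ∃ κ : ℝ, 0 < κ ∧ ∀ x y : ℝ, 0 < x → x ≤ 1 → 1 ≤ |y| →
    κ / |y| ^ 4 ≤ ‖riemannZeta (1 + x + Complex.I * y)‖ := by
  set κ : ℝ := 1 / (768 * 16 ^ 4)
  have hκ : 0 < κ := by positivity
  have hκ1 : κ ≤ 1 := by norm_num [κ]
  refine ⟨κ, hκ, fun x y hx hx1 hy => ?_⟩
  have hy0 : 0 < |y| := by linarith
  set x₀ : ℝ := κ / |y| ^ 5
  have hx₀ : 0 < x₀ := by positivity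
  have hx₀1 : x₀ ≤ 1 := by
    rw [div_le_one (by positivity)]
    exact hκ1.trans (one_le_pow₀ hy)
  have key : ∀ x' : ℝ, x₀ ≤ x' → x' ≤ 1 →
      16 * κ / |y| ^ 4 ≤ ‖riemannZeta (1 + x' + Complex.I * y)‖ := by
    intro x' h1 h2
    have h3 := pow_div_le_norm_riemannZeta_pow (hx₀.trans_le h1) h2 hy
    refine le_of_pow_le_pow_left₀ (n := 4) (by norm_num) (norm_nonneg _) (le_trans ?_ h3)
    calc (16 * κ / |y| ^ 4) ^ 4 = x₀ ^ 3 / (768 * |y|) := by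
          simp only [x₀, κ]; field_simp
      _ ≤ _ := by gcongr
  rcases le_total x₀ x with h | h
  · refine le_trans ?_ (key x h hx1)
    gcongr
    linarith
  · have h0 := key x₀ le_rfl hx₀1
    have hd : ‖riemannZeta (1 + x₀ + Complex.I * y) - riemannZeta (1 + x + Complex.I * y)‖
        ≤ 15 * |y| * ‖(1 + x₀ + Complex.I * y : ℂ) - (1 + x + Complex.I * y)‖ := by
      have hconv : Convex ℝ {s : ℂ | 1 < s.re ∧ s.re ≤ 2 ∧ s.im = y} := by
        refine (convex_halfSpace_re_gt 1).inter ((convex_halfSpace_re_le 2).inter ?_)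
        have : {s : ℂ | s.im = y} = Complex.imLm ⁻¹' {y} := rfl
        exact (convex_singleton y).linear_preimage Complex.imLm
      refine hconv.norm_image_sub_le_of_norm_deriv_le (f := riemannZeta) (fun s hs => ?_)
        (fun s hs => ?_) ?_ ?_
      · exact differentiableAt_riemannZeta (by rintro rfl; simp at hs)
      · refine (norm_deriv_riemannZeta_le hs.1).trans ?_
        have e1 : 1 ≤ ‖s - 1‖ := by
          refine le_trans ?_ (Complex.abs_im_le_norm _)
          simpa [hs.2.2] using hy
        have e2 : ‖s‖ ≤ 2 + |y| := by
          refine (Complex.norm_le_abs_re_add_abs_im s).trans ?_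
          rw [hs.2.2, abs_of_pos (by linarith [hs.1])]
          linarith [hs.2.1]
        have e3 : (‖s - 1‖⁻¹) ^ 2 ≤ 1 := pow_le_one₀ (by positivity) (inv_le_one_of_one_le₀ e1)
        linarith
      · simp; exact ⟨hx, by linarith⟩
      · simp; exact ⟨hx₀, by linarith⟩
    have he : ‖(1 + x₀ + Complex.I * y : ℂ) - (1 + x + Complex.I * y)‖ ≤ x₀ := by
      rw [show (1 + x₀ + Complex.I * y : ℂ) - (1 + x + Complex.I * y) = ((x₀ - x : ℝ) : ℂ) by
        push_cast; ring, Complex.norm_real, Real.norm_eq_abs, abs_of_nonneg (by linarith)]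
      linarith
    have hf : 15 * |y| * x₀ = 15 * (κ / |y| ^ 4) := by
      simp only [x₀]; field_simp
    have hg : 16 * κ / |y| ^ 4 = 16 * (κ / |y| ^ 4) := by ring
    have := norm_sub_norm_le (riemannZeta (1 + x₀ + Complex.I * y))
      (riemannZeta (1 + x + Complex.I * y))
    have h9 : 15 * |y| * ‖(1 + x₀ + Complex.I * y : ℂ) - (1 + x + Complex.I * y)‖
        ≤ 15 * |y| * x₀ := by gcongr
    linarith

/-- Polynomial growth of the regularised logarithmic derivative of `ζ` in `1 < Re s ≤ 2`. -/
lemma exists_norm_deriv_riemannZeta₁_div_le : ∃ C : ℝ, 0 < C ∧ ∀ s : ℂ, 1 < s.re → s.re ≤ 2 →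
    ‖deriv riemannZeta₁ s / riemannZeta₁ s‖ ≤ C * (1 + |s.im|) ^ 5 := by
  obtain ⟨κ, hκ, hlow⟩ := exists_div_pow_le_norm_riemannZeta
  have hne : ∀ s : ℂ, 1 ≤ s.re → riemannZeta₁ s ≠ 0 := by
    intro s hs
    by_cases h1 : s = 1
    · simp [h1]
    · have := riemannZeta_ne_zero_of_one_le_re hs
      rw [riemannZeta_eq_inv_sub_mul h1] at this
      exact right_ne_zero_of_mul this
  have hcomp : IsCompact (Set.Icc (1 : ℝ) 2 ×ℂ Set.Icc (-1 : ℝ) 1) :=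
    isCompact_Icc.reProdIm isCompact_Icc
  obtain ⟨C₀, hC₀⟩ := hcomp.exists_bound_of_continuousOn
    (f := fun s => deriv riemannZeta₁ s / riemannZeta₁ s)
    (differentiable_riemannZeta₁.deriv.continuous.continuousOn.div
      differentiable_riemannZeta₁.continuous.continuousOn
      fun s hs => hne s (Complex.mem_reProdIm.1 hs).1.1)
  have hderiv : ∀ s, deriv riemannZeta₁ s = riemannZeta₀ s + (s - 1) * deriv riemannZeta₀ s := by
    intro s
    unfold riemannZeta₁
    rw [deriv_const_add, deriv_fun_mul (by fun_prop) (by fun_prop)]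
    simp
  refine ⟨max C₀ 0 + 20 / κ, by positivity, fun s hs1 hs2 => ?_⟩
  set τ := 1 + |s.im| with hτ
  have hτ1 : 1 ≤ τ := by simp [hτ]
  rcases le_total |s.im| 1 with h | h
  · have := hC₀ s (Complex.mem_reProdIm.2 ⟨⟨hs1.le, hs2⟩, abs_le.1 h⟩)
    calc _ ≤ C₀ := this
      _ ≤ (max C₀ 0 + 20 / κ) * 1 := by
          have : 0 < 20 / κ := by positivity
          linarith [le_max_left C₀ 0]
      _ ≤ _ := by gcongr; exact one_le_pow₀ hτ1
  · have hs0 : s ≠ 1 := by rintro rfl; simp at hs1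
    have hz := hlow (s.re - 1) s.im (by linarith) (by linarith) h
    have hse : (1 + ((s.re - 1 : ℝ) : ℂ) + Complex.I * (s.im : ℂ)) = s := by
      apply Complex.ext <;> simp
    rw [hse] at hz
    have hF : κ / |s.im| ^ 3 ≤ ‖riemannZeta₁ s‖ := by
      have : riemannZeta₁ s = (s - 1) * riemannZeta s := by
        rw [riemannZeta_eq_inv_sub_mul hs0, mul_inv_cancel_left₀ (sub_ne_zero.2 hs0)]
      rw [this, norm_mul]
      have e1 : |s.im| ≤ ‖s - 1‖ := by
        simpa using Complex.abs_im_le_norm (s - 1)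
      calc κ / |s.im| ^ 3 = |s.im| * (κ / |s.im| ^ 4) := by
            have : |s.im| ≠ 0 := by positivity
            field_simp
        _ ≤ _ := by gcongr
    have hsn : ‖s‖ ≤ 2 * τ := by
      refine (Complex.norm_le_abs_re_add_abs_im s).trans ?_
      rw [abs_of_pos (by linarith : 0 < s.re)]
      linarith [abs_nonneg s.im]
    have hsn1 : ‖s - 1‖ ≤ τ := by
      refine (Complex.norm_le_abs_re_add_abs_im _).trans ?_
      simp
      rw [abs_of_pos (by linarith : 0 < s.re - 1)]
      linarith [abs_nonneg s.im]
    have hD : ‖deriv riemannZeta₁ s‖ ≤ 20 * τ ^ 2 := by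
      rw [hderiv]
      refine (norm_add_le _ _).trans ?_
      rw [norm_mul]
      have e1 := norm_riemannZeta₀_le hs1
      have e2 := norm_deriv_riemannZeta₀_le hs1
      have e3 : ‖s - 1‖ * ‖deriv riemannZeta₀ s‖ ≤ τ * (2 + 4 * (2 * τ)) := by
        gcongr; linarith
      nlinarith
    rw [norm_div]
    have him : 0 < |s.im| := by linarith
    calc _ ≤ (20 * τ ^ 2) / (κ / |s.im| ^ 3) := by gcongr
      _ = 20 / κ * (τ ^ 2 * |s.im| ^ 3) := by field_simp
      _ ≤ (max C₀ 0 + 20 / κ) * (τ ^ 2 * τ ^ 3) := by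
          gcongr
          · linarith [le_max_right C₀ 0]
          · linarith
      _ = _ := by ring

/-- The relative error `(ψ(x) - x) / x` in logarithmic scale `x = e ^ u`. -/
noncomputable def psiErr (u : ℝ) : ℝ := Chebyshev.psi (Real.exp u) * Real.exp (-u) - 1

/-- `psiErr` restricted to `u > 0` and damped by `e ^ (-δu)`. -/
noncomputable def dampedErr (δ : ℝ) : ℝ → ℝ :=
  (Set.Ioi (0 : ℝ)).indicator fun u => psiErr u * Real.exp (-δ * u)

lemma psi_exp_mul_exp_neg_le (u : ℝ) : Chebyshev.psi (Real.exp u) * Real.exp (-u) ≤ 6 := by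
  have h1 := Chebyshev.psi_le_const_mul_self (Real.exp_pos u).le
  have h2 : Real.log 4 + 4 ≤ 6 := by
    have : Real.log 4 = 2 * Real.log 2 := by
      rw [show (4 : ℝ) = 2 ^ 2 by norm_num, Real.log_pow]; norm_num
    have := Real.log_two_lt_d9
    linarith
  calc Chebyshev.psi (Real.exp u) * Real.exp (-u)
      ≤ (Real.log 4 + 4) * Real.exp u * Real.exp (-u) := by gcongr
    _ = Real.log 4 + 4 := by rw [mul_assoc, ← Real.exp_add]; simp
    _ ≤ 6 := h2

lemma psi_exp_mul_exp_neg_nonneg (u : ℝ) : 0 ≤ Chebyshev.psi (Real.exp u) * Real.exp (-u) :=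
  mul_nonneg (Chebyshev.psi_nonneg _) (Real.exp_pos _).le

lemma abs_psiErr_le (u : ℝ) : |psiErr u| ≤ 6 := by
  have h1 := psi_exp_mul_exp_neg_le u
  have h2 := psi_exp_mul_exp_neg_nonneg u
  rw [psiErr, abs_le]
  constructor <;> linarith

lemma measurable_psiErr : Measurable psiErr := by
  have : Measurable Chebyshev.psi := Chebyshev.psi_mono.measurable
  unfold psiErr
  fun_prop

lemma measurable_dampedErr (δ : ℝ) : Measurable (dampedErr δ) := by
  have := measurable_psiErr
  exact Measurable.indicator (by fun_prop) measurableSet_Ioi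

lemma abs_dampedErr_le {δ : ℝ} (hδ : 0 ≤ δ) (u : ℝ) : |dampedErr δ u| ≤ 6 := by
  unfold dampedErr
  by_cases hu : u ∈ Set.Ioi (0 : ℝ)
  · rw [Set.indicator_of_mem hu, abs_mul, abs_of_pos (Real.exp_pos _)]
    have h1 : Real.exp (-δ * u) ≤ 1 := Real.exp_le_one_iff.2 (by
      have := mul_nonneg hδ (le_of_lt hu); linarith)
    calc |psiErr u| * Real.exp (-δ * u) ≤ 6 * 1 := by gcongr; exact abs_psiErr_le u
      _ = 6 := by norm_num
  · simp [Set.indicator_of_notMem hu]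

lemma integrable_dampedErr {δ : ℝ} (hδ : 0 < δ) : MeasureTheory.Integrable (dampedErr δ) := by
  unfold dampedErr
  rw [MeasureTheory.integrable_indicator_iff measurableSet_Ioi]
  have h := (integrableOn_exp_mul_Ioi (neg_neg_of_pos hδ) 0)
  exact MeasureTheory.Integrable.bdd_mul h measurable_psiErr.aestronglyMeasurable
    (Eventually.of_forall fun x => abs_psiErr_le x)

lemma integral_psi_mul_cpow_eq (s : ℂ) :
    ∫ t in Set.Ioi (1 : ℝ), (Chebyshev.psi t : ℂ) * (t : ℂ) ^ (-(s + 1)) =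
      ∫ u in Set.Ioi (0 : ℝ), (Chebyshev.psi (Real.exp u) : ℂ) * Complex.exp (-s * u) := by
  have himg : Real.exp '' Set.Ioi 0 = Set.Ioi 1 := by
    ext x
    constructor
    · rintro ⟨y, hy, rfl⟩
      exact Real.one_lt_exp_iff.2 hy
    · intro hx
      exact ⟨Real.log x, Real.log_pos hx, Real.exp_log (zero_lt_one.trans hx)⟩
  rw [← himg, MeasureTheory.integral_image_eq_integral_abs_deriv_smul measurableSet_Ioi
    (fun x _ => (Real.hasDerivAt_exp x).hasDerivWithinAt) Real.exp_injective.injOn]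
  refine MeasureTheory.setIntegral_congr_fun measurableSet_Ioi fun u _ => ?_
  simp only [abs_of_pos (Real.exp_pos u), Complex.real_smul]
  rw [Complex.cpow_def_of_ne_zero (by exact_mod_cast (Real.exp_pos u).ne'),
    ← Complex.ofReal_log (Real.exp_pos u).le, Real.log_exp, mul_left_comm, Complex.ofReal_exp,
    ← Complex.exp_add]
  congr 2
  ring

lemma LSeries_vonMangoldt_eq_mul_integral {s : ℂ} (hs : 1 < s.re) :
    LSeries (fun n => (ArithmeticFunction.vonMangoldt n : ℂ)) s =
      s * ∫ u in Set.Ioi (0 : ℝ), (Chebyshev.psi (Real.exp u) : ℂ) * Complex.exp (-s * u) := by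
  have hsum : ∀ n : ℕ, ∑ k ∈ Icc 1 n, ArithmeticFunction.vonMangoldt k = Chebyshev.psi n := by
    intro n
    rw [Chebyshev.psi, Nat.floor_natCast]
    rfl
  rw [LSeries_eq_mul_integral_of_nonneg (fun n => ArithmeticFunction.vonMangoldt n)
    zero_le_one hs _ (fun n => ArithmeticFunction.vonMangoldt_nonneg), ← integral_psi_mul_cpow_eq]
  · congr 1
    refine MeasureTheory.setIntegral_congr_fun measurableSet_Ioi fun t _ => ?_
    rw [← Complex.ofReal_sum, hsum, ← Chebyshev.psi_eq_psi_coe_floor]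
  · simp only [hsum, Real.rpow_one]
    refine Asymptotics.IsBigO.of_bound (Real.log 4 + 4) (Eventually.of_forall fun n => ?_)
    rw [Real.norm_of_nonneg (Chebyshev.psi_nonneg _), Real.norm_of_nonneg (Nat.cast_nonneg _)]
    exact Chebyshev.psi_le_const_mul_self (Nat.cast_nonneg _)

lemma integral_psi_mul_cexp {s : ℂ} (hs : 1 < s.re) :
    ∫ u in Set.Ioi (0 : ℝ), (Chebyshev.psi (Real.exp u) : ℂ) * Complex.exp (-s * u) =
      (1 / (s - 1) - deriv riemannZeta₁ s / riemannZeta₁ s) / s := by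
  have hs1 : s ≠ 1 := by rintro rfl; simp at hs
  have hs0 : s ≠ 0 := by rintro rfl; simp at hs; linarith
  have h1 := LSeries_vonMangoldt_eq_mul_integral hs
  have h2 := ArithmeticFunction.LSeries_vonMangoldt_eq_deriv_riemannZeta_div hs
  have hz := riemannZeta_ne_zero_of_one_le_re hs.le
  have h3 : deriv riemannZeta s =
      - ((s - 1)⁻¹) ^ 2 * (riemannZeta₁ s) + (s - 1)⁻¹ * deriv riemannZeta₁ s := by
    have hev : riemannZeta =ᶠ[nhds s] fun s => (s - 1)⁻¹ * riemannZeta₁ s := by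
      filter_upwards [isOpen_ne.mem_nhds hs1] with w hw using riemannZeta_eq_inv_sub_mul hw
    rw [hev.deriv_eq]
    have hd : HasDerivAt (fun s : ℂ => (s - 1)⁻¹) (-1 / (s - 1) ^ 2) s := by
      exact ((hasDerivAt_id s).sub_const 1).inv (sub_ne_zero.2 hs1)
    have hd2 := (hd.mul (differentiable_riemannZeta₁ s).hasDerivAt).deriv
    refine Eq.trans hd2 ?_
    field_simp
  rw [h2, h3] at h1
  rw [riemannZeta_eq_inv_sub_mul hs1] at h1 hz
  have hF := right_ne_zero_of_mul hz
  have hs1' := sub_ne_zero.2 hs1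
  rw [eq_div_iff hs0, mul_comm, ← h1]
  field_simp
  ring

open FourierTransform in
lemma fourier_dampedErr {δ : ℝ} (hδ : 0 < δ) (ξ : ℝ) :
    𝓕 (fun u => (dampedErr δ u : ℂ)) ξ =
      -(1 + deriv riemannZeta₁ (1 + δ + 2 * Real.pi * ξ * Complex.I) /
          riemannZeta₁ (1 + δ + 2 * Real.pi * ξ * Complex.I)) /
        (1 + δ + 2 * Real.pi * ξ * Complex.I) := by
  set s : ℂ := 1 + δ + 2 * Real.pi * ξ * Complex.I with hsdef
  have hre : s.re = 1 + δ := by simp [hsdef]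
  have hs : 1 < s.re := by rw [hre]; linarith
  have hs1 : s - 1 ≠ 0 := by
    intro h
    have : (s - 1).re = 0 := by rw [h]; simp
    simp [hre] at this; linarith
  have hs0 : s ≠ 0 := by rintro h; rw [h] at hs; simp at hs; linarith
  rw [Real.fourier_real_eq_integral_exp_smul]
  have hpt : ∀ u : ℝ, Complex.exp (↑(-2 * Real.pi * u * ξ) * Complex.I) • (dampedErr δ u : ℂ) =
      (Set.Ioi (0 : ℝ)).indicator (fun u : ℝ =>
        (Chebyshev.psi (Real.exp u) : ℂ) * Complex.exp (-s * u) - Complex.exp (-(s - 1) * u)) u := by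
    intro u
    unfold dampedErr
    by_cases hu : u ∈ Set.Ioi (0 : ℝ)
    · rw [Set.indicator_of_mem hu, Set.indicator_of_mem hu, psiErr]
      push_cast
      rw [smul_eq_mul, sub_mul, mul_sub, one_mul, mul_assoc ((Chebyshev.psi (Real.exp u) : ℝ) : ℂ),
        ← Complex.exp_add, mul_left_comm, ← Complex.exp_add, ← Complex.exp_add]
      congr 3
      · rw [hsdef]; ring
      · rw [hsdef]; ring
    · simp [Set.indicator_of_notMem hu]
  simp only [hpt]
  rw [MeasureTheory.integral_indicator measurableSet_Ioi]
  have hneg : (-(s - 1)).re < 0 := by simp [hre]; linarith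
  have hi2 : MeasureTheory.IntegrableOn (fun u : ℝ => Complex.exp (-(s - 1) * u)) (Set.Ioi 0) :=
    integrableOn_exp_mul_complex_Ioi hneg 0
  have hi1 : MeasureTheory.IntegrableOn
      (fun u : ℝ => (Chebyshev.psi (Real.exp u) : ℂ) * Complex.exp (-s * u)) (Set.Ioi 0) := by
    have hm : Measurable fun u : ℝ => ((Chebyshev.psi (Real.exp u) * Real.exp (-u) : ℝ) : ℂ) := by
      have : Measurable Chebyshev.psi := Chebyshev.psi_mono.measurable
      fun_prop
    have := MeasureTheory.Integrable.bdd_mul hi2 hm.aestronglyMeasurable (c := 6)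
      (Eventually.of_forall fun x => by
        rw [Complex.norm_real, Real.norm_of_nonneg (psi_exp_mul_exp_neg_nonneg x)]
        exact psi_exp_mul_exp_neg_le x)
    refine this.congr (Eventually.of_forall fun u => ?_)
    simp only [Complex.ofReal_mul, Complex.ofReal_exp]
    rw [mul_assoc, ← Complex.exp_add]
    congr 2
    push_cast
    ring
  rw [MeasureTheory.integral_sub hi1 hi2, integral_psi_mul_cexp hs,
    integral_exp_mul_complex_Ioi hneg]
  simp only [Complex.ofReal_zero, mul_zero, Complex.exp_zero]
  generalize deriv riemannZeta₁ s / riemannZeta₁ s = F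
  field_simp
  ring

open FourierTransform in
/-- The Fourier transform of the damped error grows polynomially, uniformly in the damping. -/
lemma exists_norm_fourier_dampedErr_le : ∃ C : ℝ, 0 < C ∧ ∀ δ : ℝ, 0 < δ → δ ≤ 1 → ∀ ξ : ℝ,
    ‖𝓕 (fun u => (dampedErr δ u : ℂ)) ξ‖ ≤ C * (1 + |ξ|) ^ 5 := by
  obtain ⟨C, hC, h⟩ := exists_norm_deriv_riemannZeta₁_div_le
  refine ⟨1 + C * 7 ^ 5, by positivity, fun δ hδ hδ1 ξ => ?_⟩
  rw [fourier_dampedErr hδ]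
  set s : ℂ := 1 + δ + 2 * Real.pi * ξ * Complex.I with hsdef
  have hre : s.re = 1 + δ := by simp [hsdef]
  have him : s.im = 2 * Real.pi * ξ := by simp [hsdef]
  have h1 : 1 ≤ ‖s‖ := by
    calc (1 : ℝ) ≤ s.re := by rw [hre]; linarith
      _ ≤ ‖s‖ := Complex.re_le_norm s
  have h2 := h s (by rw [hre]; linarith) (by rw [hre]; linarith)
  have h3 : 1 + |s.im| ≤ 7 * (1 + |ξ|) := by
    rw [him, abs_mul, abs_of_pos Real.two_pi_pos]
    have := Real.pi_lt_d2
    nlinarith [abs_nonneg ξ]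
  have h4 : 1 ≤ (1 + |ξ|) ^ 5 := one_le_pow₀ (by linarith [abs_nonneg ξ])
  rw [norm_div, norm_neg, div_le_iff₀ (by linarith)]
  calc ‖1 + deriv riemannZeta₁ s / riemannZeta₁ s‖
      ≤ 1 + C * (1 + |s.im|) ^ 5 := (norm_add_le _ _).trans (by rw [norm_one]; gcongr)
    _ ≤ (1 + |ξ|) ^ 5 + C * (7 * (1 + |ξ|)) ^ 5 := by gcongr
    _ = (1 + C * 7 ^ 5) * (1 + |ξ|) ^ 5 * 1 := by ring
    _ ≤ _ := by gcongr

section FourierL2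
open MeasureTheory FourierTransform

lemma integral_fourier_mul_eq {f g : ℝ → ℂ} (hf : Integrable f) (hg : Integrable g) :
    ∫ ξ, 𝓕 f ξ * g ξ = ∫ x, f x * 𝓕 g x := by
  have := VectorFourier.integral_fourierIntegral_smul_eq_flip (L := innerₗ ℝ) (f := f) (g := g)
    (μ := volume) (ν := volume) Real.continuous_fourierChar continuous_inner hf hg
  rw [flip_innerₗ] at this
  exact this

lemma continuous_fourier_of_integrable {f : ℝ → ℂ} (hf : Integrable f) : Continuous (𝓕 f) :=
  VectorFourier.fourierIntegral_continuous Real.continuous_fourierChar (L := innerₗ ℝ)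
    continuous_inner hf

lemma fourier_comp_neg (f : ℝ → ℂ) (ξ : ℝ) : 𝓕 (fun x => f (-x)) ξ = 𝓕 f (-ξ) :=
  Real.fourier_comp_linearIsometry (LinearIsometryEquiv.neg ℝ) f ξ

lemma fourier_gaussian_mul_cexp {T : ℝ} (hT : 0 < T) (w u : ℝ) :
    𝓕 (fun t : ℝ => Complex.exp (-Real.pi * ((1 / T ^ 2 : ℝ) : ℂ) * t ^ 2 +
      2 * Real.pi * (Complex.I * w) * t)) u = (T * Real.exp (-(Real.pi * T ^ 2) * (w - u) ^ 2) : ℝ) := by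
  have hb : 0 < (((1 / T ^ 2 : ℝ) : ℂ)).re := by
    rw [Complex.ofReal_re]; positivity
  rw [fourier_gaussian_pi' hb]
  have h1 : ((1 / T ^ 2 : ℝ) : ℂ) ^ (1 / 2 : ℂ) = ((1 / T : ℝ) : ℂ) := by
    rw [show (1 / 2 : ℂ) = ((1 / 2 : ℝ) : ℂ) by push_cast; rfl,
      ← Complex.ofReal_cpow (by positivity), ← Real.sqrt_eq_rpow, Real.sqrt_div zero_le_one,
      Real.sqrt_one, Real.sqrt_sq hT.le]
  rw [h1]
  have hT' : (T : ℂ) ≠ 0 := by exact_mod_cast hT.ne'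
  push_cast
  congr 1
  · field_simp
  · congr 1
    have : (u + Complex.I * (Complex.I * w) : ℂ) ^ 2 = (w - u) ^ 2 := by
      rw [← mul_assoc, Complex.I_mul_I]; ring
    rw [this]
    field_simp

/-- Quadratic form of a Gaussian kernel, expressed on the Fourier side. -/
lemma integral_mul_gaussian_convolution {g : ℝ → ℂ} (hg : Integrable g) {T : ℝ} (hT : 0 < T) :
    ∫ w, g w * ∫ u, g u * ((T * Real.exp (-(Real.pi * T ^ 2) * (w - u) ^ 2) : ℝ) : ℂ) =
      ∫ t, 𝓕 g (-t) * (𝓕 g t * (Real.exp (-(Real.pi / T ^ 2) * t ^ 2) : ℝ)) := by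
  have hpi := Real.pi_pos
  have hGi : Integrable fun t : ℝ => ((Real.exp (-(Real.pi / T ^ 2) * t ^ 2) : ℝ) : ℂ) :=
    (integrable_exp_neg_mul_sq (by positivity)).ofReal
  have hF : Integrable fun t : ℝ => 𝓕 g t * ((Real.exp (-(Real.pi / T ^ 2) * t ^ 2) : ℝ) : ℂ) :=
    Integrable.bdd_mul hGi (continuous_fourier_of_integrable hg).aestronglyMeasurable
      (c := ∫ x, ‖g x‖) (Eventually.of_forall fun ξ =>
        VectorFourier.norm_fourierIntegral_le_integral_norm _ _ _ _ _)
  set F := fun t : ℝ => 𝓕 g t * ((Real.exp (-(Real.pi / T ^ 2) * t ^ 2) : ℝ) : ℂ)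
  have hinner : ∀ w, ∫ u, g u * ((T * Real.exp (-(Real.pi * T ^ 2) * (w - u) ^ 2) : ℝ) : ℂ) =
      𝓕 F (-w) := by
    intro w
    simp only [← fourier_gaussian_mul_cexp hT]
    have hexp : ∀ t : ℝ, Complex.exp (-Real.pi * ((1 / T ^ 2 : ℝ) : ℂ) * t ^ 2 +
      2 * Real.pi * (Complex.I * w) * t) =
        Complex.exp (2 * Real.pi * (Complex.I * w) * t) *
          ((Real.exp (-(Real.pi / T ^ 2) * t ^ 2) : ℝ) : ℂ) := by
      intro t
      rw [Complex.ofReal_exp, ← Complex.exp_add]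
      congr 1
      push_cast
      ring
    rw [← integral_fourier_mul_eq hg]
    · rw [Real.fourier_real_eq_integral_exp_smul]
      refine integral_congr_ae (Eventually.of_forall fun t => ?_)
      simp only [hexp, F, smul_eq_mul]
      rw [mul_left_comm]
      congr 2
      push_cast
      ring
    · simp only [hexp]
      refine Integrable.bdd_mul hGi (by fun_prop) (c := 1) (Eventually.of_forall fun t => ?_)
      rw [Complex.norm_exp]
      simp
  simp only [hinner]
  have h1 : ∫ w, g w * 𝓕 F (-w) = ∫ w, g (-w) * 𝓕 F w := by
    rw [← integral_neg_eq_self]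
    simp
  rw [h1, ← integral_fourier_mul_eq hg.comp_neg hF]
  simp only [fourier_comp_neg]
  rfl

lemma one_add_abs_pow_ten_mul_gaussian_le {T : ℝ} (hT : 1 ≤ T) (t : ℝ) :
    (1 + |t|) ^ 10 * Real.exp (-(Real.pi / T ^ 2) * t ^ 2) ≤
      10 ^ 5 * T ^ 10 * Real.exp (-(1 / T ^ 2) * t ^ 2) := by
  have hT0 : 0 < T := by linarith
  have h1 : (1 + |t|) ^ 2 ≤ T ^ 2 * (10 * Real.exp (t ^ 2 / T ^ 2 / 5)) := by
    have := Real.add_one_le_exp (t ^ 2 / T ^ 2 / 5)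
    have h2 : (1 + |t|) ^ 2 ≤ 2 * (1 + t ^ 2) := by
      nlinarith [sq_nonneg (1 - |t|), sq_abs t]
    have h3 : 1 + t ^ 2 ≤ T ^ 2 * (1 + t ^ 2 / T ^ 2) := by
      rw [mul_add, mul_div_cancel₀ _ (by positivity)]
      nlinarith
    have h4 : 0 ≤ t ^ 2 / T ^ 2 := by positivity
    calc (1 + |t|) ^ 2 ≤ 2 * (T ^ 2 * (1 + t ^ 2 / T ^ 2)) := by linarith
      _ = T ^ 2 * (2 * (1 + t ^ 2 / T ^ 2)) := by ring
      _ ≤ _ := mul_le_mul_of_nonneg_left (by linarith) (by positivity)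
  have h5 : (1 + |t|) ^ 10 ≤ 10 ^ 5 * T ^ 10 * Real.exp (t ^ 2 / T ^ 2) := by
    calc (1 + |t|) ^ 10 = ((1 + |t|) ^ 2) ^ 5 := by ring
      _ ≤ (T ^ 2 * (10 * Real.exp (t ^ 2 / T ^ 2 / 5))) ^ 5 := by gcongr
      _ = 10 ^ 5 * T ^ 10 * Real.exp (t ^ 2 / T ^ 2 / 5) ^ 5 := by ring
      _ = _ := by rw [← Real.exp_nat_mul]; congr 2; push_cast; ring
  calc _ ≤ 10 ^ 5 * T ^ 10 * Real.exp (t ^ 2 / T ^ 2) * Real.exp (-(Real.pi / T ^ 2) * t ^ 2) := by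
        gcongr
    _ = 10 ^ 5 * T ^ 10 * Real.exp (-((Real.pi - 1) / T ^ 2) * t ^ 2) := by
        rw [mul_assoc, ← Real.exp_add]; congr 2; ring
    _ ≤ _ := by
        gcongr
        have := Real.pi_gt_three
        linarith

lemma norm_integral_fourier_gaussian_le {g : ℝ → ℂ} {C T : ℝ}
    (hC : ∀ ξ, ‖𝓕 g ξ‖ ≤ C * (1 + |ξ|) ^ 5) (hT : 1 ≤ T) :
    ‖∫ t, 𝓕 g (-t) * (𝓕 g t * (Real.exp (-(Real.pi / T ^ 2) * t ^ 2) : ℝ))‖ ≤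
      2 * 10 ^ 5 * C ^ 2 * T ^ 11 := by
  have hT0 : 0 < T := by linarith
  have hi : Integrable fun t : ℝ => C ^ 2 * (10 ^ 5 * T ^ 10 * Real.exp (-(1 / T ^ 2) * t ^ 2)) :=
    ((integrable_exp_neg_mul_sq (by positivity)).const_mul _).const_mul _
  have hpt : ∀ t : ℝ, ‖𝓕 g (-t) * (𝓕 g t * (Real.exp (-(Real.pi / T ^ 2) * t ^ 2) : ℝ))‖ ≤
      C ^ 2 * (10 ^ 5 * T ^ 10 * Real.exp (-(1 / T ^ 2) * t ^ 2)) := by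
    intro t
    rw [norm_mul, norm_mul, Complex.norm_real, Real.norm_of_nonneg (Real.exp_pos _).le]
    have h1 := hC (-t)
    have h2 := hC t
    rw [abs_neg] at h1
    have h0 : 0 ≤ C * (1 + |t|) ^ 5 := (norm_nonneg _).trans h2
    calc _ ≤ (C * (1 + |t|) ^ 5) * ((C * (1 + |t|) ^ 5) * Real.exp (-(Real.pi / T ^ 2) * t ^ 2)) := by
          gcongr
      _ = C ^ 2 * ((1 + |t|) ^ 10 * Real.exp (-(Real.pi / T ^ 2) * t ^ 2)) := by ring
      _ ≤ _ := by gcongr C ^ 2 * ?_; exact one_add_abs_pow_ten_mul_gaussian_le hT t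
  refine (norm_integral_le_of_norm_le hi (Eventually.of_forall hpt)).trans ?_
  rw [integral_const_mul, integral_const_mul, integral_gaussian]
  have h3 : √(Real.pi / (1 / T ^ 2)) ≤ 2 * T := by
    rw [Real.sqrt_le_left (by positivity)]
    have := Real.pi_lt_four
    rw [div_div_eq_mul_div, div_one]
    nlinarith [sq_nonneg T]
  calc _ ≤ C ^ 2 * (10 ^ 5 * T ^ 10 * (2 * T)) := by gcongr
    _ = _ := by ring

lemma integral_gaussian_kernel {T : ℝ} (hT : 0 < T) :
    ∫ y : ℝ, T * Real.exp (-(Real.pi * T ^ 2) * y ^ 2) = 1 := by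
  have hpi := Real.pi_pos
  rw [integral_const_mul, integral_gaussian, div_mul_eq_div_div, div_self hpi.ne', Real.sqrt_div
    zero_le_one, Real.sqrt_one, Real.sqrt_sq hT.le]
  field_simp

lemma abs_mul_gaussian_kernel_le (T y : ℝ) :
    |y| * (T * Real.exp (-(Real.pi * T ^ 2) * y ^ 2)) ≤ Real.exp (-(T ^ 2) * y ^ 2) := by
  have h1 : |y| * T ≤ Real.exp (T ^ 2 * y ^ 2) := by
    have := Real.add_one_le_exp (T ^ 2 * y ^ 2)
    nlinarith [sq_nonneg (|y| * T - 1), sq_abs y, abs_nonneg y, sq_nonneg (|y| * T)]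
  calc _ = (|y| * T) * Real.exp (-(Real.pi * T ^ 2) * y ^ 2) := by ring
    _ ≤ Real.exp (T ^ 2 * y ^ 2) * Real.exp (-(Real.pi * T ^ 2) * y ^ 2) := by gcongr
    _ ≤ _ := by
      rw [← Real.exp_add]
      apply Real.exp_le_exp.2
      have := Real.pi_gt_three
      nlinarith [sq_nonneg (T * y)]

/-- Smoothing by a Gaussian changes the `L²` norm little if the `L¹` modulus of continuity of `g`
is Lipschitz. -/
lemma abs_integral_sq_sub_gaussian_le {g : ℝ → ℝ} (hg : Integrable g) (hm : Measurable g)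
    {B D T : ℝ} (hB : ∀ x, |g x| ≤ B) (hD : ∀ y, ∫ w, |g w - g (w - y)| ≤ D * |y|) (hT : 0 < T) :
    |(∫ w, g w ^ 2) - ∫ w, g w * ∫ u, g u * (T * Real.exp (-(Real.pi * T ^ 2) * (w - u) ^ 2))| ≤
      2 * B * D / T := by
  have hB0 : 0 ≤ B := (abs_nonneg _).trans (hB 0)
  have hD0 : 0 ≤ D := by
    have := hD 1
    rw [abs_one, mul_one] at this
    exact (integral_nonneg fun w => abs_nonneg _).trans this
  have hpi := Real.pi_pos
  set K : ℝ → ℝ := fun y => T * Real.exp (-(Real.pi * T ^ 2) * y ^ 2) with hK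
  have hKi : Integrable K := (integrable_exp_neg_mul_sq (by positivity)).const_mul _
  have hK1 : ∫ y, K y = 1 := integral_gaussian_kernel hT
  have hK0 : ∀ y, 0 ≤ K y := fun y => by positivity
  have hP1 : Integrable (fun p : ℝ × ℝ => g p.1 * K p.2) := hg.mul_prod hKi
  have hP2 : Integrable (fun p : ℝ × ℝ => g (p.1 - p.2) * K p.2) := by
    have := Integrable.convolution_integrand (ContinuousLinearMap.mul ℝ ℝ) hKi hg
    refine this.congr (Eventually.of_forall fun p => ?_)
    simp [mul_comm]
  have hP : Integrable (fun p : ℝ × ℝ => (g p.1 - g (p.1 - p.2)) * K p.2) := by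
    refine (hP1.sub hP2).congr (Eventually.of_forall fun p => ?_)
    simp only [Pi.sub_apply]; ring
  have hconv : ∀ w, ∫ u, g u * (T * Real.exp (-(Real.pi * T ^ 2) * (w - u) ^ 2)) =
      ∫ y, g (w - y) * K y := by
    intro w
    rw [← integral_sub_left_eq_self (fun u => g u * K (w - u)) volume w]
    simp
  simp only [hconv]
  have hch : Integrable (fun w => ∫ y, g (w - y) * K y) := hP2.integral_prod_left
  have hgsq : Integrable (fun w => g w ^ 2) := by
    have := Integrable.bdd_mul hg hm.aestronglyMeasurable (Eventually.of_forall hB)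
    simpa only [sq] using this
  have hgh : Integrable (fun w => g w * ∫ y, g (w - y) * K y) :=
    Integrable.bdd_mul hch hm.aestronglyMeasurable (Eventually.of_forall hB)
  rw [← integral_sub hgsq hgh]
  have hPn := hP.norm
  have hPl : Integrable (fun w => ∫ y, ‖(g w - g (w - y)) * K y‖) := hPn.integral_prod_left
  have hsec : ∀ᵐ w, Integrable fun y => g (w - y) * K y := hP2.prod_right_ae
  have hpt : ∀ᵐ w, ‖g w ^ 2 - g w * ∫ y, g (w - y) * K y‖ ≤
      B * ∫ y, ‖(g w - g (w - y)) * K y‖ := by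
    filter_upwards [hsec] with w hw
    have h1 : g w ^ 2 - g w * ∫ y, g (w - y) * K y = g w * ∫ y, (g w - g (w - y)) * K y := by
      simp only [sub_mul]
      rw [integral_sub (hKi.const_mul _) hw, integral_const_mul, hK1]
      ring
    rw [h1, norm_mul]
    gcongr
    · exact hB w
    · exact norm_integral_le_integral_norm _
  refine (norm_integral_le_of_norm_le (hPl.const_mul B) hpt).trans ?_
  rw [integral_const_mul, integral_integral_swap hPn]
  have h2 : ∀ y, ∫ w, ‖(g w - g (w - y)) * K y‖ ≤ D * Real.exp (-(T ^ 2) * y ^ 2) := by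
    intro y
    simp only [norm_mul, Real.norm_of_nonneg (hK0 y)]
    rw [integral_mul_const]
    calc _ ≤ (D * |y|) * K y := mul_le_mul_of_nonneg_right (hD y) (hK0 y)
      _ = D * (|y| * K y) := by ring
      _ ≤ _ := by gcongr; exact abs_mul_gaussian_kernel_le T y
  have h3 : ∫ y, ∫ w, ‖(g w - g (w - y)) * K y‖ ≤ ∫ y : ℝ, D * Real.exp (-(T ^ 2) * y ^ 2) :=
    integral_mono hPn.integral_prod_right
      ((integrable_exp_neg_mul_sq (by positivity)).const_mul _) h2
  rw [integral_const_mul, integral_gaussian] at h3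
  have h4 : √(Real.pi / T ^ 2) ≤ 2 / T := by
    rw [Real.sqrt_le_left (by positivity), div_pow]
    have := Real.pi_lt_four
    gcongr
    linarith
  calc _ ≤ B * (D * (2 / T)) := by gcongr; exact h3.trans (by gcongr)
    _ = _ := by ring

lemma integral_sq_le_of_fourier_le {g : ℝ → ℝ} (hg : Integrable g) (hm : Measurable g)
    {B C D T : ℝ} (hB : ∀ x, |g x| ≤ B) (hD : ∀ y, ∫ w, |g w - g (w - y)| ≤ D * |y|)
    (hC : ∀ ξ, ‖𝓕 (fun u => (g u : ℂ)) ξ‖ ≤ C * (1 + |ξ|) ^ 5) (hT : 1 ≤ T) :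
    ∫ w, g w ^ 2 ≤ 2 * 10 ^ 5 * C ^ 2 * T ^ 11 + 2 * B * D / T := by
  have hT0 : 0 < T := by linarith
  have h1 := abs_integral_sq_sub_gaussian_le hg hm hB hD hT0
  have h2 := norm_integral_fourier_gaussian_le hC hT
  have hgc : Integrable fun u => (g u : ℂ) := hg.ofReal
  rw [← integral_mul_gaussian_convolution hgc hT0] at h2
  have h3 : (∫ w, (g w : ℂ) * ∫ u, (g u : ℂ) *
      ((T * Real.exp (-(Real.pi * T ^ 2) * (w - u) ^ 2) : ℝ) : ℂ)) =
      ((∫ w, g w * ∫ u, g u * (T * Real.exp (-(Real.pi * T ^ 2) * (w - u) ^ 2)) : ℝ) : ℂ) := by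
    simp only [← Complex.ofReal_mul, integral_complex_ofReal]
  rw [h3, Complex.norm_real, Real.norm_eq_abs] at h2
  have h4 := (abs_le.1 h1).2
  have h5 := (abs_le.1 h2).2
  linarith

end FourierL2

section DampedErr
open MeasureTheory

lemma integral_abs_sub_translate_le {m : ℝ → ℝ} (hm : Monotone m) (hm0 : ∀ x, 0 ≤ m x) {c : ℝ}
    (hi : Integrable fun u => m u * Real.exp (-c * u)) {y : ℝ} (hy : 0 ≤ y) :
    ∫ w, |m w * Real.exp (-c * w) - m (w - y) * Real.exp (-c * (w - y))| ≤
      2 * (c * y) * ∫ w, m w * Real.exp (-c * w) := by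
  set p : ℝ → ℝ := fun u => m u * Real.exp (-c * u) with hp
  have hp0 : ∀ u, 0 ≤ p u := fun u => mul_nonneg (hm0 u) (Real.exp_pos _).le
  have hshift : Integrable fun w => p (w - y) := hi.comp_sub_right y
  have hle : ∀ w, Real.exp (-(c * y)) * p (w - y) ≤ p w := by
    intro w
    have : Real.exp (-(c * y)) * p (w - y) = m (w - y) * Real.exp (-c * w) := by
      simp only [hp]
      rw [mul_left_comm, ← Real.exp_add]
      congr 2
      ring
    rw [this]
    exact mul_le_mul_of_nonneg_right (hm (by linarith)) (Real.exp_pos _).le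
  rcases lt_or_ge (c * y) 0 with hcy | hcy
  · -- a decaying exponential rate is forced by integrability unless `m` vanishes
    have h1 : ∫ w, Real.exp (-(c * y)) * p (w - y) ≤ ∫ w, p w :=
      integral_mono (hshift.const_mul _) hi hle
    rw [integral_const_mul, integral_sub_right_eq_self] at h1
    have h2 : 1 < Real.exp (-(c * y)) := Real.one_lt_exp_iff.2 (by linarith)
    have h3 : 0 ≤ ∫ w, p w := integral_nonneg hp0
    have h4 : ∫ w, p w = 0 := by nlinarith
    have h5 : ∫ w, |p w - p (w - y)| ≤ ∫ w, (p w + p (w - y)) := by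
      refine integral_mono (hi.sub hshift).abs (hi.add hshift) fun w => ?_
      rw [abs_le]
      constructor <;> linarith [hp0 w, hp0 (w - y)]
    rw [integral_add hi hshift, integral_sub_right_eq_self, h4] at h5
    rw [h4]
    linarith
  · have h1 : ∫ w, |p w - p (w - y)| ≤
        ∫ w, (p w + (1 - 2 * Real.exp (-(c * y))) * p (w - y)) := by
      refine integral_mono (hi.sub hshift).abs
        (hi.add (hshift.const_mul _)) fun w => ?_
      have h2 : Real.exp (-(c * y)) ≤ 1 := Real.exp_le_one_iff.2 (by linarith)
      have h3 := mul_nonneg (sub_nonneg.2 h2) (hp0 (w - y))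
      have h4 := hle w
      simp only
      rw [abs_le]
      constructor <;> nlinarith
    rw [integral_add hi (hshift.const_mul _), integral_const_mul,
      integral_sub_right_eq_self] at h1
    have h2 : 1 - c * y ≤ Real.exp (-(c * y)) := Real.one_sub_le_exp_neg _
    have h3 : 0 ≤ ∫ w, p w := integral_nonneg hp0
    calc _ ≤ 2 * (1 - Real.exp (-(c * y))) * ∫ w, p w := by linarith
      _ ≤ _ := by gcongr; linarith

lemma dampedErr_eq (δ u : ℝ) : dampedErr δ u =
    Chebyshev.psi (Real.exp u) * Real.exp (-(1 + δ) * u) -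
      (Set.Ioi (0 : ℝ)).indicator 1 u * Real.exp (-δ * u) := by
  unfold dampedErr psiErr
  by_cases hu : u ∈ Set.Ioi (0 : ℝ)
  · rw [Set.indicator_of_mem hu, Set.indicator_of_mem hu, Pi.one_apply, sub_mul, mul_assoc,
      ← Real.exp_add]
    congr 3
    ring
  · rw [Set.indicator_of_notMem hu, Set.indicator_of_notMem hu, Chebyshev.psi_eq_zero_of_le_one]
    · simp
    · exact Real.exp_le_one_iff.2 (not_lt.1 hu)

lemma integral_abs_dampedErr_sub_translate_le {δ : ℝ} (hδ : 0 < δ) (hδ1 : δ ≤ 1) (y : ℝ) :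
    ∫ w, |dampedErr δ w - dampedErr δ (w - y)| ≤ 26 / δ * |y| := by
  wlog hy : 0 ≤ y generalizing y
  · have := this (-y) (by linarith)
    rw [abs_neg] at this
    refine le_trans (le_of_eq ?_) this
    rw [← integral_sub_right_eq_self _ (-y)]
    refine integral_congr_ae (Eventually.of_forall fun w => ?_)
    simp only
    rw [abs_sub_comm]
    congr 3
    ring
  rw [abs_of_nonneg hy]
  set p : ℝ → ℝ := fun u => Chebyshev.psi (Real.exp u) * Real.exp (-(1 + δ) * u) with hp
  set q : ℝ → ℝ := fun u => (Set.Ioi (0 : ℝ)).indicator 1 u * Real.exp (-δ * u) with hq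
  have hqe : q = (Set.Ioi (0 : ℝ)).indicator (fun u => Real.exp (-δ * u)) := by
    ext u
    by_cases hu : u ∈ Set.Ioi (0 : ℝ)
    · simp only [hq, Set.indicator_of_mem hu]; simp
    · simp only [hq, Set.indicator_of_notMem hu]; simp
  have hqi : Integrable q := by
    rw [hqe, integrable_indicator_iff measurableSet_Ioi]
    exact integrableOn_exp_mul_Ioi (neg_neg_of_pos hδ) 0
  have hqI : ∫ w, q w = 1 / δ := by
    rw [hqe, integral_indicator measurableSet_Ioi, integral_exp_mul_Ioi (neg_neg_of_pos hδ)]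
    simp
  have hgpq : ∀ u, dampedErr δ u = p u - q u := dampedErr_eq δ
  have hpi : Integrable p := by
    refine ((integrable_dampedErr hδ).add hqi).congr (Eventually.of_forall fun u => ?_)
    simp [hgpq]
  have hpI : ∫ w, p w ≤ 6 / δ := by
    have h1 : ∀ w, p w ≤ 6 * q w := by
      intro w
      by_cases hw : w ∈ Set.Ioi (0 : ℝ)
      · rw [hqe, Set.indicator_of_mem hw]
        have : p w = Chebyshev.psi (Real.exp w) * Real.exp (-w) * Real.exp (-δ * w) := by
          simp only [hp]
          rw [mul_assoc, ← Real.exp_add]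
          congr 2
          ring
        rw [this]
        gcongr
        exact psi_exp_mul_exp_neg_le w
      · rw [hqe, Set.indicator_of_notMem hw]
        simp only [hp]
        rw [Chebyshev.psi_eq_zero_of_le_one (Real.exp_le_one_iff.2 (not_lt.1 hw))]
        simp
    have h2 := integral_mono hpi (hqi.const_mul 6) h1
    rw [integral_const_mul, hqI] at h2
    calc _ ≤ 6 * (1 / δ) := h2
      _ = _ := by ring
  have hPm : Monotone fun u => Chebyshev.psi (Real.exp u) :=
    Chebyshev.psi_mono.comp Real.exp_monotone
  have hQm : Monotone ((Set.Ioi (0 : ℝ)).indicator (1 : ℝ → ℝ)) := by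
    intro a b hab
    by_cases ha : a ∈ Set.Ioi (0 : ℝ)
    · have hb : b ∈ Set.Ioi (0 : ℝ) := lt_of_lt_of_le ha hab
      rw [Set.indicator_of_mem ha, Set.indicator_of_mem hb]
      simp
    · rw [Set.indicator_of_notMem ha]
      exact Set.indicator_nonneg (fun _ _ => by simp) b
  have hbP := integral_abs_sub_translate_le hPm (fun _ => Chebyshev.psi_nonneg _) hpi hy
  have hbQ := integral_abs_sub_translate_le hQm
    (fun b => Set.indicator_nonneg (fun _ _ => by simp) b) hqi hy
  change ∫ w, |p w - p (w - y)| ≤ 2 * ((1 + δ) * y) * ∫ w, p w at hbP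
  change ∫ w, |q w - q (w - y)| ≤ 2 * (δ * y) * ∫ w, q w at hbQ
  have hsum : ∫ w, |dampedErr δ w - dampedErr δ (w - y)| ≤
      ∫ w, (|p w - p (w - y)| + |q w - q (w - y)|) := by
    refine integral_mono (((integrable_dampedErr hδ)).sub
      ((integrable_dampedErr hδ).comp_sub_right y)).abs
      ((hpi.sub (hpi.comp_sub_right y)).abs.add (hqi.sub (hqi.comp_sub_right y)).abs) fun w => ?_
    simp only [hgpq]
    rw [show p w - q w - (p (w - y) - q (w - y)) = (p w - p (w - y)) - (q w - q (w - y)) by ring]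
    exact abs_sub _ _
  have hpd : Integrable fun w => |p w - p (w - y)| := (hpi.sub (hpi.comp_sub_right y)).abs
  have hqd : Integrable fun w => |q w - q (w - y)| := (hqi.sub (hqi.comp_sub_right y)).abs
  rw [integral_add hpd hqd] at hsum
  rw [hqI] at hbQ
  have h1 : 2 * ((1 + δ) * y) * ∫ w, p w ≤ 2 * (2 * y) * (6 / δ) := by
    have h0 : 0 ≤ ∫ w, p w := integral_nonneg fun w =>
      mul_nonneg (Chebyshev.psi_nonneg _) (Real.exp_pos _).le
    gcongr
    linarith
  have h2 : 2 * (δ * y) * (1 / δ) ≤ 2 * y / δ := by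
    rw [mul_one_div]
    gcongr 2 * ?_ / _
    nlinarith
  calc _ ≤ 2 * (2 * y) * (6 / δ) + 2 * y / δ := by linarith
    _ = _ := by ring

lemma exists_integral_dampedErr_sq_le : ∃ K : ℝ, 0 < K ∧ ∀ δ : ℝ, 0 < δ → δ ≤ 1 →
    ∫ w, dampedErr δ w ^ 2 ≤ K * δ ^ (-(11 / 12) : ℝ) := by
  obtain ⟨C, hC, h⟩ := exists_norm_fourier_dampedErr_le
  refine ⟨2 * 10 ^ 5 * C ^ 2 + 312, by positivity, fun δ hδ hδ1 => ?_⟩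
  have hT : 1 ≤ δ ^ (-(1 / 12) : ℝ) := Real.one_le_rpow_of_pos_of_le_one_of_nonpos hδ hδ1 (by norm_num)
  have h1 := integral_sq_le_of_fourier_le (integrable_dampedErr hδ) (measurable_dampedErr δ)
    (abs_dampedErr_le hδ.le) (integral_abs_dampedErr_sub_translate_le hδ hδ1) (h δ hδ hδ1) hT
  have h2 : (δ ^ (-(1 / 12) : ℝ)) ^ 11 = δ ^ (-(11 / 12) : ℝ) := by
    rw [← Real.rpow_natCast, ← Real.rpow_mul hδ.le]; norm_num
  have h3 : 2 * 6 * (26 / δ) / δ ^ (-(1 / 12) : ℝ) = 312 * δ ^ (-(11 / 12) : ℝ) := by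
    rw [show (-(11 / 12) : ℝ) = -1 - -(1 / 12) by norm_num, Real.rpow_sub hδ, Real.rpow_neg_one]
    ring
  rw [h2, h3] at h1
  linarith

/-- `L¹` form of the prime number theorem with a power saving in the logarithmic scale. -/
lemma exists_integral_abs_psiErr_le : ∃ K : ℝ, 0 < K ∧ ∀ W : ℝ, 1 ≤ W →
    ∫ u in (0)..W, |psiErr u| ≤ K * W ^ (23 / 24 : ℝ) := by
  obtain ⟨K, hK, h⟩ := exists_integral_dampedErr_sq_le
  refine ⟨1 + 9 * K, by positivity, fun W hW => ?_⟩
  have hW0 : 0 < W := by linarith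
  have h1 := h (1 / W) (by positivity) (by rw [div_le_one hW0]; exact hW)
  have h1' : (1 / W) ^ (-(11 / 12) : ℝ) = W ^ (11 / 12 : ℝ) := by
    rw [one_div, Real.inv_rpow hW0.le, ← Real.rpow_neg hW0.le, neg_neg]
  rw [h1'] at h1
  set l : ℝ := W ^ (-(1 / 24) : ℝ) with hl
  have hl0 : 0 < l := by positivity
  have hgi := integrable_dampedErr (δ := 1 / W) (by positivity)
  have hgsq : Integrable fun w => dampedErr (1 / W) w ^ 2 := by
    have := Integrable.bdd_mul hgi (measurable_dampedErr _).aestronglyMeasurable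
      (Eventually.of_forall (abs_dampedErr_le (δ := 1 / W) (by positivity)))
    simpa only [sq] using this
  have hpt : ∀ u ∈ Set.Ioc 0 W, |psiErr u| ≤ l + 9 * l⁻¹ * dampedErr (1 / W) u ^ 2 := by
    intro u hu
    have hd : dampedErr (1 / W) u = psiErr u * Real.exp (-(1 / W) * u) :=
      Set.indicator_of_mem (show u ∈ Set.Ioi 0 from hu.1) _
    have h3 : psiErr u ^ 2 ≤ 9 * dampedErr (1 / W) u ^ 2 := by
      have h4 : psiErr u = dampedErr (1 / W) u * Real.exp (u / W) := by
        rw [hd, mul_assoc, ← Real.exp_add]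
        rw [show -(1 / W) * u + u / W = 0 by ring]; simp
      have h5 : Real.exp (u / W) ≤ 3 := by
        have : Real.exp (u / W) ≤ Real.exp 1 :=
          Real.exp_le_exp.2 (by rw [div_le_one hW0]; exact hu.2)
        have := Real.exp_one_lt_d9
        linarith
      rw [h4, mul_pow]
      have : Real.exp (u / W) ^ 2 ≤ 3 ^ 2 := by gcongr
      nlinarith [sq_nonneg (dampedErr (1 / W) u)]
    have h6 : |psiErr u| ≤ l + l⁻¹ * psiErr u ^ 2 := by
      rw [← sub_nonneg]
      have : l + l⁻¹ * psiErr u ^ 2 - |psiErr u| =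
          l⁻¹ * ((l - |psiErr u| / 2) ^ 2 + 3 / 4 * psiErr u ^ 2) := by
        rw [← sq_abs (psiErr u)]
        field_simp
        ring
      rw [this]
      positivity
    calc _ ≤ l + l⁻¹ * psiErr u ^ 2 := h6
      _ ≤ l + l⁻¹ * (9 * dampedErr (1 / W) u ^ 2) := by gcongr
      _ = _ := by ring
  rw [intervalIntegral.integral_of_le hW0.le]
  have hfin : IntegrableOn (fun _ : ℝ => l) (Set.Ioc 0 W) := by simp
  have hsq2 : IntegrableOn (fun u => 9 * l⁻¹ * dampedErr (1 / W) u ^ 2) (Set.Ioc 0 W) :=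
    (hgsq.const_mul _).integrableOn
  calc ∫ u in Set.Ioc 0 W, |psiErr u|
      ≤ ∫ u in Set.Ioc 0 W, (l + 9 * l⁻¹ * dampedErr (1 / W) u ^ 2) := by
        refine setIntegral_mono_on ?_ (hfin.add hsq2) measurableSet_Ioc hpt
        exact Measure.integrableOn_of_bounded (M := 6) (by simp)
          measurable_psiErr.abs.aestronglyMeasurable
          (Eventually.of_forall fun u => by simpa using abs_psiErr_le u)
    _ = l * W + 9 * l⁻¹ * ∫ u in Set.Ioc 0 W, dampedErr (1 / W) u ^ 2 := by
        rw [integral_add hfin hsq2, integral_const_mul]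
        simp [hW0.le, mul_comm]
    _ ≤ l * W + 9 * l⁻¹ * (K * W ^ (11 / 12 : ℝ)) := by
        gcongr
        exact (setIntegral_le_integral hgsq (Eventually.of_forall fun _ => sq_nonneg _)).trans h1
    _ = (1 + 9 * K) * W ^ (23 / 24 : ℝ) := by
        have h7 : l * W = W ^ (23 / 24 : ℝ) := by
          rw [hl, show (23 / 24 : ℝ) = -(1 / 24) + 1 by norm_num, Real.rpow_add hW0, Real.rpow_one]
        have h8 : l⁻¹ * W ^ (11 / 12 : ℝ) = W ^ (23 / 24 : ℝ) := by
          rw [hl, ← Real.rpow_neg hW0.le, ← Real.rpow_add hW0]; norm_num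
        rw [h7, show 9 * l⁻¹ * (K * W ^ (11 / 12 : ℝ)) = 9 * K * (l⁻¹ * W ^ (11 / 12 : ℝ)) by ring, h8]
        ring

end DampedErr

section PsiSum
open MeasureTheory

lemma intervalIntegrable_abs_psiErr (a b : ℝ) :
    IntervalIntegrable (fun u => |psiErr u|) volume a b := by
  rw [intervalIntegrable_iff]
  exact Measure.integrableOn_of_bounded (M := 6) (by simp)
    measurable_psiErr.abs.aestronglyMeasurable
    (Eventually.of_forall fun u => by simpa using abs_psiErr_le u)

lemma abs_psi_sub_self_le {x : ℝ} (hx : 0 < x) {m : ℕ} (hm : 1 ≤ m) :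
    |Chebyshev.psi (x / m) - x / m| ≤
      2 * x * (∫ u in (Real.log (x / (m + 1)))..(Real.log (x / m)), |psiErr u|) +
        ((Chebyshev.psi (x / m) + x / m) - (Chebyshev.psi (x / (m + 1)) + x / (m + 1))) := by
  have hm0 : (0 : ℝ) < m := by exact_mod_cast hm
  have hm1 : (1 : ℝ) ≤ m := by exact_mod_cast hm
  have hxm : 0 < x / m := by positivity
  have hxm1 : 0 < x / (m + 1) := by positivity
  have hle : x / (m + 1) ≤ x / m := by gcongr; linarith
  set a := Real.log (x / (m + 1))
  set b := Real.log (x / m)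
  set Δ := (Chebyshev.psi (x / m) + x / m) - (Chebyshev.psi (x / (m + 1)) + x / (m + 1))
  set E := |Chebyshev.psi (x / m) - x / m|
  have hab : a ≤ b := Real.log_le_log hxm1 hle
  have hL : 1 / (2 * m) ≤ b - a := by
    have h1 : b - a = Real.log ((m + 1) / m) := by
      rw [← Real.log_div hxm.ne' hxm1.ne']
      congr 1
      field_simp
    have h2 := Real.one_sub_inv_le_log_of_pos (x := ((m : ℝ) + 1) / m) (by positivity)
    rw [h1]
    refine le_trans ?_ h2
    rw [inv_div, one_sub_div (by positivity), add_sub_cancel_left]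
    exact one_div_le_one_div_of_le (by positivity) (by linarith)
  have hpt : ∀ u ∈ Set.Icc a b, E - Δ ≤ x / m * |psiErr u| := by
    intro u hu
    have hu1 : x / (m + 1) ≤ Real.exp u := by
      rw [← Real.exp_log hxm1]; exact Real.exp_le_exp.2 hu.1
    have hu2 : Real.exp u ≤ x / m := by
      rw [← Real.exp_log hxm]; exact Real.exp_le_exp.2 hu.2
    have h3 := Chebyshev.psi_mono hu1
    have h4 := Chebyshev.psi_mono hu2
    have h5 : Real.exp u * |psiErr u| = |Chebyshev.psi (Real.exp u) - Real.exp u| := by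
      rw [← abs_of_pos (Real.exp_pos u), ← abs_mul, abs_of_pos (Real.exp_pos u), psiErr, mul_sub,
        mul_left_comm, ← Real.exp_add]
      simp
    have h6 : Real.exp u * |psiErr u| ≤ x / m * |psiErr u| := by gcongr
    refine le_trans ?_ h6
    rw [h5]
    simp only [E, Δ]
    have h7 := neg_abs_le (Chebyshev.psi (Real.exp u) - Real.exp u)
    have h8 := le_abs_self (Chebyshev.psi (Real.exp u) - Real.exp u)
    rcases abs_cases (Chebyshev.psi (x / m) - x / m) with ⟨h9, _⟩ | ⟨h9, _⟩ <;> rw [h9] <;> linarith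
  have hint : (b - a) * (E - Δ) ≤ x / m * ∫ u in a..b, |psiErr u| := by
    have := intervalIntegral.integral_mono_on (f := fun _ => E - Δ) hab (by simp)
      ((intervalIntegrable_abs_psiErr a b).const_mul (x / m)) hpt
    rw [intervalIntegral.integral_const, intervalIntegral.integral_const_mul, smul_eq_mul] at this
    exact this
  have hI0 : 0 ≤ ∫ u in a..b, |psiErr u| :=
    intervalIntegral.integral_nonneg hab fun _ _ => abs_nonneg _
  rcases le_total (E - Δ) 0 with h0 | h0
  · have : 0 ≤ 2 * x * ∫ u in a..b, |psiErr u| := by positivity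
    linarith
  · have h10 : 1 / (2 * m) * (E - Δ) ≤ x / m * ∫ u in a..b, |psiErr u| :=
      (mul_le_mul_of_nonneg_right hL h0).trans hint
    have h11 : E - Δ ≤ 2 * x * ∫ u in a..b, |psiErr u| := by
      calc E - Δ = 2 * m * (1 / (2 * m) * (E - Δ)) := by field_simp
        _ ≤ 2 * m * (x / m * ∫ u in a..b, |psiErr u|) := by gcongr
        _ = _ := by field_simp
    linarith

/-- The Chebyshev error is small on average over the points `x / m`. -/
lemma exists_sum_abs_psi_sub_self_le : ∃ K : ℝ, 0 < K ∧ ∀ x : ℝ, Real.exp 1 ≤ x →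
    ∑ m ∈ Ioc 0 ⌊x⌋₊, |Chebyshev.psi (x / m) - x / m| ≤ K * (x * Real.log x ^ (23 / 24 : ℝ)) := by
  obtain ⟨K, hK, h⟩ := exists_integral_abs_psiErr_le
  refine ⟨2 * K + 19, by positivity, fun x hx => ?_⟩
  have hx0 : 0 < x := (Real.exp_pos 1).trans_le hx
  have hx1 : 1 ≤ x := by linarith [Real.add_one_le_exp 1]
  have hlog : 1 ≤ Real.log x := by rwa [Real.le_log_iff_exp_le hx0]
  set M := ⌊x⌋₊
  set H : ℝ → ℝ := fun y => Chebyshev.psi y + y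
  set Φ : ℝ → ℝ := fun v => ∫ u in (0)..v, |psiErr u|
  set f : ℕ → ℝ := fun k => 2 * x * Φ (Real.log (x / (k + 1))) + H (x / (k + 1))
  have hterm : ∀ k ∈ range M, |Chebyshev.psi (x / (k + 1 : ℕ)) - x / (k + 1 : ℕ)| ≤ f k - f (k + 1) := by
    intro k _
    have h1 := abs_psi_sub_self_le hx0 (m := k + 1) (by omega)
    have h2 : ∫ u in (Real.log (x / ((k + 1 : ℕ) + 1)))..(Real.log (x / (k + 1 : ℕ))), |psiErr u| =
        Φ (Real.log (x / (k + 1 : ℕ))) - Φ (Real.log (x / ((k + 1 : ℕ) + 1))) :=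
      (intervalIntegral.integral_interval_sub_left (intervalIntegrable_abs_psiErr _ _)
        (intervalIntegrable_abs_psiErr _ _)).symm
    rw [h2] at h1
    refine h1.trans (le_of_eq ?_)
    simp only [f, H]
    push_cast
    ring
  have hsum : ∑ m ∈ Ioc 0 M, |Chebyshev.psi (x / m) - x / m| ≤ f 0 - f M := by
    rw [← Finset.sum_range_sub' f M]
    have : Ioc 0 M = (range M).image (· + 1) := by
      ext n
      simp only [mem_Ioc, mem_image, mem_range]
      constructor
      · rintro ⟨h1, h2⟩
        exact ⟨n - 1, by omega, by omega⟩
      · rintro ⟨k, h1, rfl⟩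
        omega
    rw [this, sum_image (fun a _ b _ hab => by simpa using hab)]
    exact sum_le_sum hterm
  have hf0 : f 0 ≤ 2 * x * (K * Real.log x ^ (23 / 24 : ℝ)) + 7 * x := by
    have h3 : H x ≤ 7 * x := by
      have h4 := psi_exp_mul_exp_neg_le (Real.log x)
      rw [Real.exp_log hx0, Real.exp_neg, Real.exp_log hx0, ← div_eq_mul_inv, div_le_iff₀ hx0] at h4
      simp only [H]
      linarith
    have h5 := h _ hlog
    simp only [f, Nat.cast_zero, zero_add, div_one]
    have h6 : 2 * x * Φ (Real.log x) ≤ 2 * x * (K * Real.log x ^ (23 / 24 : ℝ)) := by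
      gcongr
    linarith
  have hfM : -(12 * x) ≤ f M := by
    have hM : (M : ℝ) ≤ x := Nat.floor_le hx0.le
    have hy : 1 / 2 ≤ x / (M + 1) := by
      rw [div_le_div_iff₀ (by norm_num) (by positivity)]; linarith
    have hy' : x / (M + 1) ≤ 1 := by
      rw [div_le_one (by positivity)]; exact (Nat.lt_floor_add_one x).le
    have hly : -1 ≤ Real.log (x / (M + 1)) := by
      have := Real.one_sub_inv_le_log_of_pos (x := x / (M + 1)) (by positivity)
      have h8 : (x / (M + 1))⁻¹ ≤ 2 := by
        rw [inv_le_comm₀ (by positivity) (by norm_num)]; linarith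
      linarith
    have hly' : Real.log (x / (M + 1)) ≤ 0 := Real.log_nonpos (by positivity) hy'
    have hΦ : -6 ≤ Φ (Real.log (x / (M + 1))) := by
      have h9 := intervalIntegral.norm_integral_le_of_norm_le_const (f := fun u => |psiErr u|)
        (a := 0) (b := Real.log (x / (M + 1))) (C := 6) (fun u _ => by simpa using abs_psiErr_le u)
      rw [sub_zero, abs_of_nonpos hly', Real.norm_eq_abs] at h9
      have := neg_abs_le (Φ (Real.log (x / (M + 1))))
      change |Φ (Real.log (x / (M + 1)))| ≤ _ at h9
      linarith
    have hH : 0 ≤ H (x / (M + 1)) := add_nonneg (Chebyshev.psi_nonneg _) (by positivity)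
    have : 2 * x * (-6) ≤ 2 * x * Φ (Real.log (x / (M + 1))) := by gcongr
    simp only [f]
    linarith
  have hone : 1 ≤ Real.log x ^ (23 / 24 : ℝ) := Real.one_le_rpow hlog (by norm_num)
  have : 19 * x ≤ 19 * x * Real.log x ^ (23 / 24 : ℝ) := le_mul_of_one_le_right (by positivity) hone
  linarith

end PsiSum

lemma sum_inv_sqrt_le (N : ℕ) : ∑ n ∈ Ioc 0 N, 1 / √(n : ℝ) ≤ 2 * √N := by
  induction N with
  | zero => simp
  | succ k ih =>
    rw [sum_Ioc_succ_top (Nat.zero_le k)]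
    have h1 : 1 / √((k + 1 : ℕ) : ℝ) ≤ 2 * (√((k + 1 : ℕ) : ℝ) - √k) := by
      have h2 : 0 < √((k + 1 : ℕ) : ℝ) := by positivity
      have h3 : √(k : ℝ) ≤ √((k + 1 : ℕ) : ℝ) := Real.sqrt_le_sqrt (by push_cast; linarith)
      have h4 := Real.sq_sqrt (show (0 : ℝ) ≤ (k + 1 : ℕ) by positivity)
      have h5 := Real.sq_sqrt (show (0 : ℝ) ≤ k by positivity)
      rw [div_le_iff₀ h2]
      push_cast at *
      nlinarith [sq_nonneg (√((k : ℝ) + 1) - √k)]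
    linarith

lemma sum_sqrt_div_le {x : ℝ} (hx : 0 ≤ x) : ∑ n ∈ Ioc 0 ⌊x⌋₊, √(x / n) ≤ 2 * x := by
  have h1 : ∀ n : ℕ, √(x / n) = √x * (1 / √(n : ℝ)) := fun n => by
    rw [Real.sqrt_div hx]; ring
  simp only [h1]
  rw [← mul_sum]
  calc _ ≤ √x * (2 * √x) := by
        gcongr
        exact (sum_inv_sqrt_le _).trans (by gcongr; exact Nat.floor_le hx)
    _ = _ := by nlinarith [Real.mul_self_sqrt hx]

/-- The completely multiplicative function `n ↦ z ^ Ω(n)`. -/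
noncomputable def powOmega (z : ℂ) : ArithmeticFunction ℂ :=
  ⟨fun n => if n = 0 then 0 else z ^ ArithmeticFunction.cardFactors n, by simp⟩

lemma powOmega_apply {z : ℂ} {n : ℕ} (hn : n ≠ 0) :
    powOmega z n = z ^ ArithmeticFunction.cardFactors n := if_neg hn

lemma powOmega_prime (z : ℂ) {p : ℕ} (hp : p.Prime) : powOmega z p = z := by
  rw [powOmega_apply hp.ne_zero, ArithmeticFunction.cardFactors_apply_prime hp, pow_one]

lemma powOmega_mul (z : ℂ) {m n : ℕ} (hm : m ≠ 0) (hn : n ≠ 0) :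
    powOmega z (m * n) = powOmega z m * powOmega z n := by
  rw [powOmega_apply (mul_ne_zero hm hn), powOmega_apply hm, powOmega_apply hn,
    ArithmeticFunction.cardFactors_mul hm hn, pow_add]

lemma norm_powOmega {z : ℂ} (hz : ‖z‖ = 1) {n : ℕ} (hn : n ≠ 0) : ‖powOmega z n‖ = 1 := by
  rw [powOmega_apply hn, norm_pow, hz, one_pow]

lemma norm_powOmega_le {z : ℂ} (hz : ‖z‖ = 1) (n : ℕ) : ‖powOmega z n‖ ≤ 1 := by
  by_cases hn : n = 0
  · simp [hn]
  · exact (norm_powOmega hz hn).le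

lemma sum_powOmega_mul_log (z : ℂ) (N : ℕ) :
    ∑ n ∈ Ioc 0 N, powOmega z n * Real.log n =
      ∑ m ∈ Ioc 0 N, powOmega z m *
        ∑ d ∈ Ioc 0 (N / m), powOmega z d * ArithmeticFunction.vonMangoldt d := by
  let g : ArithmeticFunction ℂ :=
    ⟨fun d => powOmega z d * ArithmeticFunction.vonMangoldt d, by simp⟩
  have hg : ∀ d, g d = powOmega z d * ArithmeticFunction.vonMangoldt d := fun _ => rfl
  have h := ArithmeticFunction.sum_Ioc_mul_eq_sum_sum (powOmega z) g N
  simp only [hg] at h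
  rw [← h]
  refine sum_congr rfl fun n hn => ?_
  rw [ArithmeticFunction.mul_apply, ← ArithmeticFunction.vonMangoldt_sum,
    ← Nat.sum_divisorsAntidiagonal' (f := fun _ j => ArithmeticFunction.vonMangoldt j),
    Complex.ofReal_sum, mul_sum]
  refine sum_congr rfl fun p hp => ?_
  obtain ⟨hp1, hp2⟩ := Nat.mem_divisorsAntidiagonal.1 hp
  rw [← hp1] at hp2 ⊢
  rw [powOmega_mul z (left_ne_zero_of_mul hp2) (right_ne_zero_of_mul hp2), hg, mul_assoc]

lemma norm_sum_powOmega_mul_vonMangoldt_sub_le {z : ℂ} (hz : ‖z‖ = 1) (y : ℝ) :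
    ‖∑ d ∈ Ioc 0 ⌊y⌋₊, powOmega z d * (ArithmeticFunction.vonMangoldt d : ℂ) -
      z * Chebyshev.psi y‖ ≤ 2 * (Chebyshev.psi y - Chebyshev.theta y) := by
  rw [Chebyshev.psi_sub_theta_eq_sum_not_prime, Chebyshev.psi, Complex.ofReal_sum, mul_sum,
    ← sum_sub_distrib, mul_sum, sum_filter]
  refine norm_sum_le_of_le _ fun d hd => ?_
  rw [← sub_mul, norm_mul, Complex.norm_real,
    Real.norm_of_nonneg ArithmeticFunction.vonMangoldt_nonneg]
  by_cases hp : d.Prime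
  · simp [hp, powOmega_prime]
  · rw [if_pos hp]
    refine mul_le_mul_of_nonneg_right ?_ ArithmeticFunction.vonMangoldt_nonneg
    calc _ ≤ ‖powOmega z d‖ + ‖z‖ := norm_sub_le _ _
      _ ≤ 2 := by linarith [norm_powOmega_le hz d]

/-- Approximate functional equation for the partial sums of `z ^ Ω(n)`. -/
lemma exists_norm_sum_powOmega_mul_log_sub_le : ∃ K : ℝ, 0 < K ∧ ∀ z : ℂ, ‖z‖ = 1 →
    ∀ x : ℝ, Real.exp 1 ≤ x →
    ‖(∑ n ∈ Ioc 0 ⌊x⌋₊, powOmega z n) * Real.log x - z * x * ∑ n ∈ Ioc 0 ⌊x⌋₊, powOmega z n / n‖ ≤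
      K * (x * Real.log x ^ (23 / 24 : ℝ)) := by
  obtain ⟨K, hK, hE⟩ := exists_sum_abs_psi_sub_self_le
  obtain ⟨C, hC⟩ := Chebyshev.psi_sub_theta_le_mul_sqrt
  refine ⟨K + (4 * |C| + 4), by positivity, fun z hz x hx => ?_⟩
  have hx0 : 0 < x := (Real.exp_pos 1).trans_le hx
  have hlog : 1 ≤ Real.log x := by rwa [Real.le_log_iff_exp_le hx0]
  set N := ⌊x⌋₊ with hN
  have hfl : ∀ m : ℕ, N / m = ⌊x / m⌋₊ := fun m => (Nat.floor_div_natCast x m).symm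
  have hsq := sum_sqrt_div_le hx0.le
  -- compare `log x` with `log n`
  have h1 : ‖(∑ n ∈ Ioc 0 N, powOmega z n) * Real.log x - ∑ n ∈ Ioc 0 N, powOmega z n * Real.log n‖
      ≤ 4 * x := by
    rw [sum_mul, ← sum_sub_distrib]
    refine (norm_sum_le_of_le (f := fun n : ℕ => powOmega z n * Real.log x -
      powOmega z n * Real.log n) _ (n := fun n : ℕ => 2 * √(x / n)) fun n hn => ?_).trans ?_
    · have hn0 : (0 : ℝ) < n := by exact_mod_cast (mem_Ioc.1 hn).1
      have hnx : (n : ℝ) ≤ x := (Nat.le_floor_iff hx0.le).1 (mem_Ioc.1 hn).2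
      rw [← mul_sub, norm_mul, ← Complex.ofReal_sub, Complex.norm_real,
        ← Real.log_div hx0.ne' hn0.ne']
      have hy : 1 ≤ x / n := by rwa [one_le_div hn0]
      rw [Real.norm_of_nonneg (Real.log_nonneg hy)]
      have h2 : Real.log (x / n) ≤ 2 * √(x / n) := by
        have h3 := Real.log_le_sub_one_of_pos (x := √(x / n)) (by positivity)
        rw [Real.log_sqrt (by positivity)] at h3
        linarith
      calc _ ≤ 1 * Real.log (x / n) := by
            gcongr
            · exact Real.log_nonneg hy
            · exact norm_powOmega_le hz n
        _ ≤ _ := by linarith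
    · rw [← mul_sum]; linarith
  -- replace the inner sum of `powOmega z d * Λ d` by `z * ψ (x / m)`
  have h2 : ‖∑ n ∈ Ioc 0 N, powOmega z n * Real.log n -
      ∑ m ∈ Ioc 0 N, powOmega z m * (z * Chebyshev.psi (x / m))‖ ≤ 4 * |C| * x := by
    rw [sum_powOmega_mul_log, ← sum_sub_distrib]
    refine (norm_sum_le_of_le _ (n := fun m : ℕ => 2 * |C| * √(x / m)) fun m hm => ?_).trans ?_
    · rw [← mul_sub, norm_mul, hfl]
      have h3 := norm_sum_powOmega_mul_vonMangoldt_sub_le hz (x / m)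
      have h4 : C * √(x / m) ≤ |C| * √(x / m) := by gcongr; exact le_abs_self C
      calc _ ≤ 1 * (2 * (Chebyshev.psi (x / m) - Chebyshev.theta (x / m))) :=
            mul_le_mul (norm_powOmega_le hz m) h3 (norm_nonneg _) zero_le_one
        _ ≤ _ := by linarith [hC (x / m)]
    · rw [← mul_sum]
      calc _ ≤ 2 * |C| * (2 * x) := by gcongr
        _ = _ := by ring
  -- replace `ψ (x / m)` by `x / m`
  have h3 : ‖∑ m ∈ Ioc 0 N, powOmega z m * (z * Chebyshev.psi (x / m)) -
      z * x * ∑ n ∈ Ioc 0 N, powOmega z n / n‖ ≤ K * (x * Real.log x ^ (23 / 24 : ℝ)) := by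
    rw [mul_sum, ← sum_sub_distrib]
    refine (norm_sum_le_of_le _ (n := fun m : ℕ => |Chebyshev.psi (x / m) - x / m|)
      fun m hm => ?_).trans (hE x hx)
    have : powOmega z m * (z * Chebyshev.psi (x / m)) - z * x * (powOmega z m / m) =
        powOmega z m * z * ((Chebyshev.psi (x / m) - x / m : ℝ) : ℂ) := by
      push_cast; ring
    rw [this, norm_mul, norm_mul, hz, Complex.norm_real, Real.norm_eq_abs, mul_one]
    exact mul_le_of_le_one_left (abs_nonneg _) (norm_powOmega_le hz m)
  have hone : 1 ≤ Real.log x ^ (23 / 24 : ℝ) := Real.one_le_rpow hlog (by norm_num)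
  have h4 : (4 * |C| + 4) * x ≤ (4 * |C| + 4) * (x * Real.log x ^ (23 / 24 : ℝ)) := by
    gcongr
    exact le_mul_of_one_le_right hx0.le hone
  calc _ ≤ 4 * x + 4 * |C| * x + K * (x * Real.log x ^ (23 / 24 : ℝ)) := by
        refine (norm_sub_le_norm_sub_add_norm_sub _ _ _).trans (add_le_add ?_ h3)
        exact (norm_sub_le_norm_sub_add_norm_sub _ _ _).trans (add_le_add h1 h2)
    _ ≤ _ := by linarith

/-- Mean value of `z ^ Ω(n)` over `n ≤ e ^ v`, normalised by `e ^ v`. -/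
noncomputable def omegaMean (z : ℂ) (v : ℝ) : ℂ :=
  (∑ n ∈ Ioc 0 ⌊Real.exp v⌋₊, powOmega z n) * Real.exp (-v)

/-- A primitive of `omegaMean`. -/
noncomputable def omegaPrimitive (z : ℂ) (v : ℝ) : ℂ :=
  ∑ n ∈ Ioc 0 ⌊Real.exp v⌋₊, powOmega z n * ((1 / n : ℝ) - Real.exp (-v) : ℝ)

lemma norm_omegaMean_le {z : ℂ} (hz : ‖z‖ = 1) (v : ℝ) : ‖omegaMean z v‖ ≤ 1 := by
  rw [omegaMean, norm_mul, Complex.norm_real, Real.norm_of_nonneg (Real.exp_pos _).le]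
  have h1 : ‖∑ n ∈ Ioc 0 ⌊Real.exp v⌋₊, powOmega z n‖ ≤ Real.exp v := by
    refine (norm_sum_le_of_le _ fun n _ => norm_powOmega_le hz n).trans ?_
    simp only [sum_const, Nat.card_Ioc, tsub_zero, nsmul_eq_mul, mul_one]
    exact Nat.floor_le (Real.exp_pos _).le
  calc _ ≤ Real.exp v * Real.exp (-v) := by gcongr
    _ = 1 := by rw [← Real.exp_add]; simp

lemma exists_norm_omegaMean_sub_le : ∃ K : ℝ, 0 < K ∧ ∀ z : ℂ, ‖z‖ = 1 → ∀ v : ℝ, 1 ≤ v →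
    ‖omegaMean z v - z * omegaPrimitive z v / v‖ ≤ K * v ^ (-(1 / 24) : ℝ) := by
  obtain ⟨K, hK, h⟩ := exists_norm_sum_powOmega_mul_log_sub_le
  refine ⟨K + 1, by positivity, fun z hz v hv => ?_⟩
  have hv0 : 0 < v := by linarith
  have h1 := h z hz (Real.exp v) (Real.exp_le_exp.2 hv)
  rw [Real.log_exp] at h1
  have h2 : omegaPrimitive z v = ∑ n ∈ Ioc 0 ⌊Real.exp v⌋₊, powOmega z n / n - omegaMean z v := by
    rw [omegaPrimitive, omegaMean, sum_mul, ← sum_sub_distrib]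
    refine sum_congr rfl fun n _ => ?_
    push_cast
    ring
  set A := ∑ n ∈ Ioc 0 ⌊Real.exp v⌋₊, powOmega z n with hA
  set T := ∑ n ∈ Ioc 0 ⌊Real.exp v⌋₊, powOmega z n / n with hT
  have hS : omegaMean z v = A * Real.exp (-v) := rfl
  have hv0' : (v : ℂ) ≠ 0 := by exact_mod_cast hv0.ne'
  have hee : (Real.exp v : ℂ) * (Real.exp (-v) : ℂ) = 1 := by
    rw [← Complex.ofReal_mul, ← Real.exp_add]; simp
  have h3 : omegaMean z v - z * omegaPrimitive z v / v =
      (A * v - z * Real.exp v * T) * (Real.exp (-v) : ℂ) / v + z * omegaMean z v / v := by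
    rw [h2, hS]
    field_simp
    linear_combination z * T * hee
  have hpow : v ^ (23 / 24 : ℝ) / v = v ^ (-(1 / 24) : ℝ) := by
    rw [show (-(1 / 24) : ℝ) = 23 / 24 - 1 by norm_num, Real.rpow_sub_one hv0.ne']
  have h4 : ‖(A * v - z * Real.exp v * T) * (Real.exp (-v) : ℂ) / v‖ ≤ K * v ^ (-(1 / 24) : ℝ) := by
    rw [norm_div, norm_mul, Complex.norm_real, Complex.norm_real, Real.norm_of_nonneg hv0.le,
      Real.norm_of_nonneg (Real.exp_pos _).le]
    calc _ ≤ K * (Real.exp v * v ^ (23 / 24 : ℝ)) * Real.exp (-v) / v := by gcongr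
      _ = K * (Real.exp v * Real.exp (-v)) * (v ^ (23 / 24 : ℝ) / v) := by ring
      _ = _ := by rw [hpow, ← Real.exp_add]; simp
  have h5 : ‖z * omegaMean z v / v‖ ≤ 1 * v ^ (-(1 / 24) : ℝ) := by
    rw [norm_div, norm_mul, hz, one_mul, Complex.norm_real, Real.norm_of_nonneg hv0.le, ← hpow,
      one_mul]
    gcongr
    exact (norm_omegaMean_le hz v).trans (Real.one_le_rpow hv (by norm_num))
  rw [h3, add_mul]
  exact (norm_add_le _ _).trans (add_le_add h4 h5)

section Ode
open Topology

lemma hasDerivWithinAt_omegaPrimitive (z : ℂ) (v : ℝ) :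
    HasDerivWithinAt (omegaPrimitive z) (omegaMean z v) (Set.Ici v) v := by
  have hev : ∀ᶠ w in 𝓝[≥] v, ⌊Real.exp w⌋₊ = ⌊Real.exp v⌋₊ := by
    have h1 : ∀ᶠ w in 𝓝 v, Real.exp w < ⌊Real.exp v⌋₊ + 1 :=
      Real.continuous_exp.continuousAt.eventually_lt continuousAt_const (Nat.lt_floor_add_one _)
    filter_upwards [h1.filter_mono nhdsWithin_le_nhds, self_mem_nhdsWithin] with w hw hvw
    refine le_antisymm (Nat.lt_succ_iff.1 ?_) (Nat.floor_mono (Real.exp_le_exp.2 hvw))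
    rw [Nat.floor_lt (Real.exp_pos _).le]
    push_cast
    exact hw
  have hd : HasDerivAt (fun w : ℝ => ∑ n ∈ Ioc 0 ⌊Real.exp v⌋₊,
      powOmega z n * ((1 / n : ℝ) - Real.exp (-w) : ℝ)) (omegaMean z v) v := by
    rw [omegaMean, sum_mul]
    refine HasDerivAt.fun_sum fun n _ => HasDerivAt.const_mul _ (HasDerivAt.ofReal_comp ?_)
    have := ((hasDerivAt_neg v).exp).const_sub (1 / n : ℝ)
    simpa using this
  refine hd.hasDerivWithinAt.congr_of_eventuallyEq ?_ rfl
  filter_upwards [hev] with w hw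
  rw [omegaPrimitive, hw]

lemma omegaPrimitive_eq_sum_max {z : ℂ} {v : ℝ} {M : ℕ} (h : Real.exp v ≤ M) :
    omegaPrimitive z v =
      ∑ n ∈ Ioc 0 M, powOmega z n * (max 0 ((1 / n : ℝ) - Real.exp (-v)) : ℝ) := by
  have hsub : Ioc 0 ⌊Real.exp v⌋₊ ⊆ Ioc 0 M :=
    Ioc_subset_Ioc_right (Nat.floor_le_of_le h)
  have hinv : ∀ n : ℕ, n ∈ Ioc 0 M → ((n : ℝ) ≤ Real.exp v ↔ Real.exp (-v) ≤ 1 / n) := by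
    intro n hn
    have hn0 : (0 : ℝ) < n := by exact_mod_cast (mem_Ioc.1 hn).1
    rw [Real.exp_neg, one_div, inv_le_inv₀ (Real.exp_pos _) hn0]
  rw [omegaPrimitive, ← sum_subset hsub]
  · refine sum_congr rfl fun n hn => ?_
    rw [max_eq_right]
    have := (Nat.le_floor_iff (Real.exp_pos v).le).1 (mem_Ioc.1 hn).2
    linarith [(hinv n (hsub hn)).1 this]
  · intro n hn hn'
    rw [max_eq_left, Complex.ofReal_zero, mul_zero]
    by_contra hcon
    push Not at hcon
    refine hn' (mem_Ioc.2 ⟨(mem_Ioc.1 hn).1, ?_⟩)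
    rw [Nat.le_floor_iff (Real.exp_pos v).le, hinv n hn]
    linarith

lemma continuous_omegaPrimitive (z : ℂ) : Continuous (omegaPrimitive z) := by
  rw [continuous_iff_continuousAt]
  intro v
  have hev : omegaPrimitive z =ᶠ[𝓝 v] fun w => ∑ n ∈ Ioc 0 ⌈Real.exp (v + 1)⌉₊,
      powOmega z n * (max 0 ((1 / n : ℝ) - Real.exp (-w)) : ℝ) := by
    filter_upwards [Iio_mem_nhds (show v < v + 1 by linarith)] with w hw
    exact omegaPrimitive_eq_sum_max
      ((Real.exp_le_exp.2 (le_of_lt hw)).trans (Nat.le_ceil _))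
  refine ContinuousAt.congr ?_ hev.symm
  fun_prop

lemma continuous_omegaPrimitive_left (v : ℝ) : Continuous fun z => omegaPrimitive z v := by
  unfold omegaPrimitive
  refine continuous_finsetSum _ fun n hn => Continuous.mul ?_ continuous_const
  have : n ≠ 0 := (mem_Ioc.1 hn).1.ne'
  simp only [powOmega_apply this]
  fun_prop

lemma omegaPrimitive_one (v : ℝ) : omegaPrimitive 1 v =
    ((harmonic ⌊Real.exp v⌋₊ : ℝ) - ⌊Real.exp v⌋₊ * Real.exp (-v) : ℝ) := by
  rw [omegaPrimitive, harmonic_eq_sum_Icc]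
  have : ∀ n ∈ Ioc 0 ⌊Real.exp v⌋₊, powOmega 1 n * (((1 / n : ℝ) - Real.exp (-v) : ℝ) : ℂ) =
      (((1 / n : ℝ) - Real.exp (-v) : ℝ) : ℂ) := by
    intro n hn
    rw [powOmega_apply (mem_Ioc.1 hn).1.ne', one_pow, one_mul]
  rw [sum_congr rfl this, ← Complex.ofReal_sum, sum_sub_distrib]
  congr 1
  push_cast
  simp only [one_div, sum_const, Nat.card_Ioc, nsmul_eq_mul, tsub_zero]
  rfl

lemma norm_omegaPrimitive_one_sub_le {v : ℝ} (hv : 0 ≤ v) : ‖omegaPrimitive 1 v - v‖ ≤ 1 := by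
  rw [omegaPrimitive_one, ← Complex.ofReal_sub, Complex.norm_real, Real.norm_eq_abs]
  set N := ⌊Real.exp v⌋₊ with hN
  have h1 := log_add_one_le_harmonic N
  have h2 := harmonic_le_one_add_log N
  have hN1 : 1 ≤ N := by
    rw [hN, Nat.one_le_floor_iff]
    exact Real.one_le_exp hv
  have hle : (N : ℝ) ≤ Real.exp v := Nat.floor_le (Real.exp_pos _).le
  have h3 : v ≤ Real.log (N + 1 : ℕ) := by
    rw [Real.le_log_iff_exp_le (by positivity)]
    push_cast
    exact (Nat.lt_floor_add_one _).le
  have h4 : Real.log N ≤ v := by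
    rw [Real.log_le_iff_le_exp (by exact_mod_cast hN1)]
    exact hle
  have h5 : (N : ℝ) * Real.exp (-v) ≤ 1 := by
    calc _ ≤ Real.exp v * Real.exp (-v) := by gcongr
      _ = 1 := by rw [← Real.exp_add]; simp
  have h6 : 0 ≤ (N : ℝ) * Real.exp (-v) := by positivity
  rw [abs_le]
  constructor <;> linarith

lemma norm_omegaPrimitive_le {z : ℂ} (hz : ‖z‖ = 1) {v : ℝ} (hv : 0 ≤ v) :
    ‖omegaPrimitive z v‖ ≤ 1 + v := by
  have h1 : ‖omegaPrimitive z v‖ ≤ ‖omegaPrimitive 1 v‖ := by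
    have hnn : ∀ n ∈ Ioc 0 ⌊Real.exp v⌋₊, 0 ≤ (1 / n : ℝ) - Real.exp (-v) := by
      intro n hn
      have hn0 : (0 : ℝ) < n := by exact_mod_cast (mem_Ioc.1 hn).1
      have := (Nat.le_floor_iff (Real.exp_pos v).le).1 (mem_Ioc.1 hn).2
      rw [sub_nonneg, Real.exp_neg, one_div, inv_le_inv₀ (Real.exp_pos _) hn0]
      exact this
    have h2 : omegaPrimitive 1 v =
        ((∑ n ∈ Ioc 0 ⌊Real.exp v⌋₊, ((1 / n : ℝ) - Real.exp (-v)) : ℝ) : ℂ) := by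
      rw [omegaPrimitive, Complex.ofReal_sum]
      refine sum_congr rfl fun n hn => ?_
      rw [powOmega_apply (mem_Ioc.1 hn).1.ne', one_pow, one_mul]
    rw [h2, Complex.norm_real, Real.norm_of_nonneg (sum_nonneg hnn)]
    refine norm_sum_le_of_le _ fun n hn => ?_
    rw [norm_mul, Complex.norm_real, Real.norm_of_nonneg (hnn n hn)]
    exact mul_le_of_le_one_left (hnn n hn) (norm_powOmega_le hz n)
  have h2 := norm_omegaPrimitive_one_sub_le hv
  calc _ ≤ ‖omegaPrimitive 1 v‖ := h1
    _ = ‖(omegaPrimitive 1 v - v) + v‖ := by rw [sub_add_cancel]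
    _ ≤ ‖omegaPrimitive 1 v - v‖ + ‖(v : ℂ)‖ := norm_add_le _ _
    _ ≤ 1 + v := by
      rw [Complex.norm_real, Real.norm_of_nonneg hv]
      linarith

/-- `omegaPrimitive` renormalised by its expected growth `v ^ z`. -/
noncomputable def omegaRatio (z : ℂ) (v : ℝ) : ℂ :=
  omegaPrimitive z v * Complex.exp (-z * Real.log v)

lemma norm_cexp_mul_log (z : ℂ) {v : ℝ} (hv : 0 < v) :
    ‖Complex.exp (z * Real.log v)‖ = v ^ z.re := by
  rw [Complex.norm_exp, Complex.re_mul_ofReal, Real.rpow_def_of_pos hv, mul_comm]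

lemma hasDerivWithinAt_omegaRatio (z : ℂ) {v : ℝ} (hv : 0 < v) :
    HasDerivWithinAt (omegaRatio z)
      ((omegaMean z v - z * omegaPrimitive z v / v) * Complex.exp (-z * Real.log v))
      (Set.Ici v) v := by
  have h1 : HasDerivAt (fun v : ℝ => Complex.exp (-z * Real.log v))
      (Complex.exp (-z * Real.log v) * (-z * ((v⁻¹ : ℝ) : ℂ))) v :=
    (((Real.hasDerivAt_log hv.ne').ofReal_comp).const_mul (-z)).cexp
  have h2 := (hasDerivWithinAt_omegaPrimitive z v).mul h1.hasDerivWithinAt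
  refine h2.congr_deriv ?_
  push_cast
  ring

lemma norm_omegaRatio_sub_le {K : ℝ} {z : ℂ}
    (hK : ∀ v : ℝ, 1 ≤ v → ‖omegaMean z v - z * omegaPrimitive z v / v‖ ≤ K * v ^ (-(1 / 24) : ℝ))
    {M a b : ℝ} (ha : 1 ≤ a) (hab : a ≤ b)
    (hM : ∀ u ∈ Set.Icc a b, u ^ (-(1 / 24) - z.re : ℝ) ≤ M * u ^ (-(1 / 48) - 1 : ℝ)) :
    ‖omegaRatio z b - omegaRatio z a‖ ≤ M * (48 * K) * a ^ (-(1 / 48) : ℝ) := by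
  have hK0 : 0 ≤ K := by
    have := (norm_nonneg _).trans (hK 1 le_rfl)
    simpa using this
  have hM0 : 0 ≤ M := by
    have h1 := hM a ⟨le_rfl, hab⟩
    have h2 : 0 < a ^ (-(1 / 24) - z.re : ℝ) := Real.rpow_pos_of_pos (by linarith) _
    have h3 : 0 < a ^ (-(1 / 48) - 1 : ℝ) := Real.rpow_pos_of_pos (by linarith) _
    by_contra hcon
    push Not at hcon
    nlinarith
  have hbd : ∀ u : ℝ, 1 ≤ u → HasDerivAt
      (fun u : ℝ => M * (48 * K) * (a ^ (-(1 / 48) : ℝ) - u ^ (-(1 / 48) : ℝ)))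
      (M * K * u ^ (-(1 / 48) - 1 : ℝ)) u := by
    intro u hu
    have h1 := ((Real.hasDerivAt_rpow_const (x := u) (p := (-(1 / 48) : ℝ))
      (Or.inl (by linarith))).const_sub (a ^ (-(1 / 48) : ℝ))).const_mul (M * (48 * K))
    refine h1.congr_deriv ?_
    ring
  have hcont : ContinuousOn (omegaRatio z) (Set.Icc a b) := by
    refine (continuous_omegaPrimitive z).continuousOn.mul ?_
    refine Complex.continuous_exp.comp_continuousOn (continuousOn_const.mul ?_)
    refine Complex.continuous_ofReal.comp_continuousOn (Real.continuousOn_log.mono ?_)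
    intro u hu
    simp only [Set.mem_compl_iff, Set.mem_singleton_iff]
    linarith [hu.1]
  have h := image_norm_le_of_norm_deriv_right_le_deriv_boundary'
    (f := fun u => omegaRatio z u - omegaRatio z a)
    (f' := fun u => (omegaMean z u - z * omegaPrimitive z u / u) * Complex.exp (-z * Real.log u))
    (B := fun u : ℝ => M * (48 * K) * (a ^ (-(1 / 48) : ℝ) - u ^ (-(1 / 48) : ℝ)))
    (B' := fun u : ℝ => M * K * u ^ (-(1 / 48) - 1 : ℝ)) (a := a) (b := b)
    (hcont.sub continuousOn_const)
    (fun u hu => (hasDerivWithinAt_omegaRatio z (by linarith [hu.1])).sub_const _)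
    (by simp)
    (fun u hu => (hbd u (by linarith [hu.1])).continuousAt.continuousWithinAt)
    (fun u hu => (hbd u (by linarith [hu.1])).hasDerivWithinAt)
    (fun u hu => by
      have hu1 : 1 ≤ u := by linarith [hu.1]
      have hu0 : 0 < u := by linarith
      rw [norm_mul, norm_cexp_mul_log _ hu0, Complex.neg_re]
      calc _ ≤ K * u ^ (-(1 / 24) : ℝ) * u ^ (-z.re) := by gcongr; exact hK u hu1
        _ = K * u ^ (-(1 / 24) - z.re : ℝ) := by
          rw [mul_assoc, ← Real.rpow_add hu0, sub_eq_add_neg]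
        _ ≤ K * (M * u ^ (-(1 / 48) - 1 : ℝ)) := by gcongr; exact hM u ⟨hu.1, hu.2.le⟩
        _ = _ := by ring)
    ⟨hab, le_rfl⟩
  refine h.trans ?_
  have : 0 ≤ b ^ (-(1 / 48) : ℝ) := Real.rpow_nonneg (by linarith) _
  gcongr
  linarith

end Ode

section Asymptotic
open Topology

lemma omegaRatio_one (z : ℂ) : omegaRatio z 1 = omegaPrimitive z 1 := by
  simp [omegaRatio]

lemma norm_omegaRatio_one_sub_one_le {v : ℝ} (hv : 0 < v) : ‖omegaRatio 1 v - 1‖ ≤ v⁻¹ := by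
  have hv0 : (v : ℂ) ≠ 0 := by exact_mod_cast hv.ne'
  have h : omegaRatio 1 v - 1 = (omegaPrimitive 1 v - v) * (v : ℂ)⁻¹ := by
    rw [omegaRatio, sub_mul, mul_inv_cancel₀ hv0, neg_mul, one_mul, Complex.exp_neg,
      ← Complex.ofReal_exp, Real.exp_log hv]
  rw [h, norm_mul, norm_inv, Complex.norm_real, Real.norm_of_nonneg hv.le]
  exact mul_le_of_le_one_left (by positivity) (norm_omegaPrimitive_one_sub_le hv.le)

lemma continuous_omegaRatio_left (v : ℝ) : Continuous fun z => omegaRatio z v := by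
  unfold omegaRatio
  exact (continuous_omegaPrimitive_left v).mul (by fun_prop)

lemma mul_omegaPrimitive_div (z : ℂ) {v : ℝ} (hv : 0 < v) :
    z * omegaPrimitive z v / v = z * omegaRatio z v * Complex.exp ((z - 1) * Real.log v) := by
  have hv0 : (v : ℂ) ≠ 0 := by exact_mod_cast hv.ne'
  have h : Complex.exp ((z - 1) * Real.log v) = Complex.exp (z * Real.log v) / v := by
    rw [sub_mul, one_mul, Complex.exp_sub, ← Complex.ofReal_exp, Real.exp_log hv]
  rw [h, omegaRatio, neg_mul, Complex.exp_neg]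
  field_simp [Complex.exp_ne_zero]

lemma one_sub_re_eq_norm_sq {z : ℂ} (hz : ‖z‖ = 1) : 1 - z.re = ‖z - 1‖ ^ 2 / 2 := by
  have h : z.re * z.re + z.im * z.im = 1 := by
    rw [← Complex.normSq_apply, Complex.normSq_eq_norm_sq, hz, one_pow]
  rw [← Complex.normSq_eq_norm_sq, Complex.normSq_apply]
  simp only [Complex.sub_re, Complex.one_re, Complex.sub_im, Complex.one_im]
  nlinarith

/-- The mean value of `z ^ Ω(n)` is `(log x) ^ (z - 1)`, up to a small multiple of its modulus and
a power saving in `log x`, uniformly on the unit circle. -/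
lemma exists_norm_omegaMean_sub_cexp_le {η : ℝ} (hη : 0 < η) : ∃ κ : ℝ, 0 < κ ∧ ∃ K : ℝ, 0 < K ∧
    ∀ v : ℝ, 1 ≤ v →
    ∀ z : ℂ, ‖z‖ = 1 → ‖omegaMean z v - Complex.exp ((z - 1) * Real.log v)‖ ≤
      η * v ^ (z.re - 1) + K * v ^ (-κ) := by
  obtain ⟨K, hK, hmean⟩ := exists_norm_omegaMean_sub_le
  obtain ⟨v₀, hv₀, hv₀1, hv₀2⟩ : ∃ v₀ : ℝ, 1 ≤ v₀ ∧ 48 * K * v₀ ^ (-(1 / 48) : ℝ) ≤ η / 4 ∧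
      v₀⁻¹ ≤ η / 4 := by
    have h1 : Tendsto (fun v : ℝ => 48 * K * v ^ (-(1 / 48) : ℝ)) atTop (𝓝 (48 * K * 0)) :=
      (tendsto_rpow_neg_atTop (by norm_num)).const_mul _
    rw [mul_zero] at h1
    have h2 := tendsto_inv_atTop_zero (𝕜 := ℝ)
    exact ((eventually_ge_atTop 1).and ((h1.eventually_le_const (by positivity)).and
      (h2.eventually_le_const (by positivity)))).exists
  obtain ⟨ρ, hρ, hcont⟩ : ∃ ρ > 0, ∀ z : ℂ, ‖z - 1‖ < ρ →
      ‖z * omegaRatio z v₀ - omegaRatio 1 v₀‖ < η / 4 := by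
    have h := (continuous_id.mul (continuous_omegaRatio_left v₀)).continuousAt (x := (1 : ℂ))
    obtain ⟨ρ, hρ, h⟩ := Metric.continuousAt_iff.1 h (η / 4) (by positivity)
    refine ⟨ρ, hρ, fun z hz => ?_⟩
    simpa [dist_eq_norm] using h (x := z) (by simpa [dist_eq_norm] using hz)
  have hκ : 0 < min (1 / 48) (ρ ^ 2 / 2) := by positivity
  -- for `v ≤ v₀` everything is bounded
  refine ⟨min (1 / 48) (ρ ^ 2 / 2), hκ,
    K + (3 + 48 * K) * v₀ ^ min (1 / 48) (ρ ^ 2 / 2) + (3 + 48 * K), by positivity,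
    fun v hv z hz => ?_⟩
  set κ := min (1 / 48) (ρ ^ 2 / 2) with hκdef
  have hv0 : 0 < v := by linarith
  have hzre : z.re ≤ 1 := by rw [← hz]; exact Complex.re_le_norm z
  have hratio_one : ‖omegaRatio z 1‖ ≤ 2 := by
    rw [omegaRatio_one]
    linarith [norm_omegaPrimitive_le hz zero_le_one]
  have hpowκ : v ^ (-(1 / 48) : ℝ) ≤ v ^ (-κ) :=
    Real.rpow_le_rpow_of_exponent_le hv (neg_le_neg (min_le_left _ _))
  have hpow24 : v ^ (-(1 / 24) : ℝ) ≤ v ^ (-κ) :=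
    (Real.rpow_le_rpow_of_exponent_le hv (by norm_num)).trans hpowκ
  have hposκ : 0 < v ^ (-κ) := Real.rpow_pos_of_pos hv0 _
  have hposre : 0 < v ^ (z.re - 1) := Real.rpow_pos_of_pos hv0 _
  have hmain : ‖omegaMean z v - Complex.exp ((z - 1) * Real.log v)‖ ≤
      K * v ^ (-κ) + ‖z * omegaRatio z v - 1‖ * v ^ (z.re - 1) := by
    calc _ = ‖(omegaMean z v - z * omegaPrimitive z v / v) +
          (z * omegaRatio z v - 1) * Complex.exp ((z - 1) * Real.log v)‖ := by
          rw [mul_omegaPrimitive_div z hv0]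
          congr 1
          ring
      _ ≤ _ := by
          refine (norm_add_le _ _).trans ?_
          rw [norm_mul, norm_cexp_mul_log _ hv0, Complex.sub_re, Complex.one_re]
          gcongr
          exact (hmean z hz v hv).trans (by gcongr)
  have hmul : ‖z * omegaRatio z v - 1‖ ≤ ‖omegaRatio z v‖ + 1 := by
    refine (norm_sub_le _ _).trans ?_
    rw [norm_mul, hz, one_mul, norm_one]
  suffices h : ‖z * omegaRatio z v - 1‖ * v ^ (z.re - 1) ≤ η * v ^ (z.re - 1) +
      ((3 + 48 * K) * v₀ ^ κ + (3 + 48 * K)) * v ^ (-κ) by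
    linarith
  have hextra : 0 ≤ (3 + 48 * K) * v₀ ^ κ := by positivity
  rcases le_total z.re (1 - 1 / 48) with hre | hre
  · -- the crude bound away from `z = 1`
    have h1 := norm_omegaRatio_sub_le (hmean z hz) (M := v ^ (1 - 1 / 48 - z.re)) le_rfl hv ?_
    · have h2 : 1 ≤ v ^ (1 - 1 / 48 - z.re) := Real.one_le_rpow hv (by linarith)
      have h3 : ‖omegaRatio z v‖ ≤ 2 + v ^ (1 - 1 / 48 - z.re) * (48 * K) := by
        rw [Real.one_rpow, mul_one] at h1
        linarith [norm_sub_norm_le (omegaRatio z v) (omegaRatio z 1)]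
      calc _ ≤ ((3 + 48 * K) * v ^ (1 - 1 / 48 - z.re)) * v ^ (z.re - 1) := by
            gcongr
            nlinarith
        _ = (3 + 48 * K) * v ^ (-(1 / 48) : ℝ) := by
            rw [mul_assoc, ← Real.rpow_add hv0]
            ring_nf
        _ ≤ (3 + 48 * K) * v ^ (-κ) := by gcongr
        _ ≤ _ := by nlinarith [mul_pos hη hposre, mul_nonneg hextra hposκ.le]
    · intro u hu
      have hu0 : 0 < u := by linarith [hu.1]
      have h2 : u ^ (1 - 1 / 48 - z.re) ≤ v ^ (1 - 1 / 48 - z.re) :=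
        Real.rpow_le_rpow hu0.le hu.2 (by linarith)
      calc _ = u ^ (1 - 1 / 48 - z.re) * u ^ (-(1 / 48) - 1 : ℝ) := by
            rw [← Real.rpow_add hu0]
            ring_nf
        _ ≤ _ := by gcongr
  have hM : ∀ a b : ℝ, 1 ≤ a → ∀ u ∈ Set.Icc a b,
      u ^ (-(1 / 24) - z.re : ℝ) ≤ 1 * u ^ (-(1 / 48) - 1 : ℝ) := by
    intro a b ha u hu
    rw [one_mul]
    exact Real.rpow_le_rpow_of_exponent_le (ha.trans hu.1) (by linarith)
  have hR : ‖omegaRatio z v‖ ≤ 2 + 48 * K := by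
    have h1 := norm_omegaRatio_sub_le (hmean z hz) (M := 1) le_rfl hv (hM _ _ le_rfl)
    rw [Real.one_rpow, mul_one, one_mul] at h1
    linarith [norm_sub_norm_le (omegaRatio z v) (omegaRatio z 1)]
  rcases lt_or_ge v v₀ with hvv | hvv
  · have h1 : 1 ≤ v₀ ^ κ * v ^ (-κ) := by
      rw [Real.rpow_neg hv0.le, ← div_eq_mul_inv, one_le_div (Real.rpow_pos_of_pos hv0 _)]
      exact Real.rpow_le_rpow hv0.le hvv.le hκ.le
    have h2 : v ^ (z.re - 1) ≤ 1 := Real.rpow_le_one_of_one_le_of_nonpos hv (by linarith)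
    calc _ ≤ (3 + 48 * K) * 1 := by gcongr; linarith
      _ ≤ (3 + 48 * K) * (v₀ ^ κ * v ^ (-κ)) := by gcongr
      _ ≤ _ := by nlinarith [mul_pos hη hposre, mul_pos (show 0 < 3 + 48 * K by positivity) hposκ]
  rcases lt_or_ge ‖z - 1‖ ρ with hz1 | hz1
  · have h1 := norm_omegaRatio_sub_le (hmean z hz) (M := 1) hv₀ hvv (hM _ _ hv₀)
    have h2 : ‖z * omegaRatio z v - 1‖ ≤ η := by
      calc _ = ‖z * (omegaRatio z v - omegaRatio z v₀) +
            ((z * omegaRatio z v₀ - omegaRatio 1 v₀) + (omegaRatio 1 v₀ - 1))‖ := by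
            congr 1
            ring
        _ ≤ ‖omegaRatio z v - omegaRatio z v₀‖ +
            (‖z * omegaRatio z v₀ - omegaRatio 1 v₀‖ + ‖omegaRatio 1 v₀ - 1‖) := by
            refine (norm_add_le _ _).trans (add_le_add ?_ (norm_add_le _ _))
            rw [norm_mul, hz, one_mul]
        _ ≤ _ := by
            linarith [hcont z hz1, norm_omegaRatio_one_sub_one_le (show 0 < v₀ by linarith)]
    calc _ ≤ η * v ^ (z.re - 1) := by gcongr
      _ ≤ _ := by nlinarith [mul_nonneg hextra hposκ.le, mul_pos hK hposκ]
  · have h1 : v ^ (z.re - 1) ≤ v ^ (-κ) := by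
      refine Real.rpow_le_rpow_of_exponent_le hv ?_
      have h2 := one_sub_re_eq_norm_sq hz
      have h3 : κ ≤ ρ ^ 2 / 2 := min_le_right _ _
      nlinarith
    calc _ ≤ (3 + 48 * K) * v ^ (-κ) := by gcongr; linarith
      _ ≤ _ := by nlinarith [mul_pos hη hposre, mul_nonneg hextra hposκ.le]

end Asymptotic

lemma norm_pow_succ_sub_pow_succ_le {a b : ℂ} {R : ℝ} (ha : ‖a‖ ≤ R) (hb : ‖b‖ ≤ R) (n : ℕ) :
    ‖a ^ (n + 1) - b ^ (n + 1)‖ ≤ (n + 1) * ‖a - b‖ * R ^ n := by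
  have hR : 0 ≤ R := (norm_nonneg a).trans ha
  induction n with
  | zero => simp
  | succ n ih =>
    calc ‖a ^ (n + 1 + 1) - b ^ (n + 1 + 1)‖
        = ‖a ^ (n + 1) * (a - b) + (a ^ (n + 1) - b ^ (n + 1)) * b‖ := by
          congr 1
          ring
      _ ≤ ‖a‖ ^ (n + 1) * ‖a - b‖ + ‖a ^ (n + 1) - b ^ (n + 1)‖ * ‖b‖ := by
          refine (norm_add_le _ _).trans ?_
          rw [norm_mul, norm_mul, norm_pow]
      _ ≤ R ^ (n + 1) * ‖a - b‖ + ((n + 1) * ‖a - b‖ * R ^ n) * R := by gcongr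
      _ = _ := by
          push_cast
          ring

/-- The generating function of the weights of `e2bin`. -/
noncomputable def binGen (M : ℕ) (z : ℂ) : ℂ := ((1 + z ^ 2) / 2) ^ M * ((1 + z) / 2)

lemma norm_one_add_sq_div_two {z : ℂ} (hz : ‖z‖ = 1) : ‖(1 + z ^ 2) / 2‖ = |z.re| := by
  have h : (1 + z ^ 2) / 2 = z * (z.re : ℂ) := by
    have h1 : z * (starRingEnd ℂ) z = 1 := by rw [Complex.mul_conj', hz]; simp
    have h2 : z + (starRingEnd ℂ) z = ((2 * z.re : ℝ) : ℂ) := Complex.add_conj z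
    push_cast at h2
    linear_combination (-1 / 2 : ℂ) * h1 + z / 2 * h2
  rw [h, norm_mul, hz, one_mul, Complex.norm_real, Real.norm_eq_abs]

lemma norm_one_add_div_two_sq {z : ℂ} (hz : ‖z‖ = 1) : ‖(1 + z) / 2‖ ^ 2 = (1 + z.re) / 2 := by
  have h := one_sub_re_eq_norm_sq (z := -z) (by rwa [norm_neg])
  rw [show -z - 1 = -(1 + z) by ring, norm_neg, Complex.neg_re] at h
  rw [norm_div, div_pow]
  norm_num
  linarith

lemma norm_cexp_sub_binGen_le_of_re_nonpos {z : ℂ} (hz : ‖z‖ = 1) (hre : z.re ≤ 0) {M : ℕ}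
    (hM : 1 ≤ M) {L : ℝ} (hML : M ≤ L) :
    ‖Complex.exp ((z - 1) * L) - binGen M z‖ ≤ 2 / √M := by
  have hM0 : (1 : ℝ) ≤ M := by exact_mod_cast hM
  have hs0 : 0 < √(M : ℝ) := Real.sqrt_pos.2 (by linarith)
  have hsq : √(M : ℝ) ^ 2 = M := Real.sq_sqrt (by linarith)
  have hzre : -1 ≤ z.re := by
    rw [← hz]
    exact (abs_le.1 (Complex.abs_re_le_norm z)).1
  have h1 : ‖Complex.exp ((z - 1) * L)‖ ≤ 1 / √M := by
    rw [Complex.norm_exp, Complex.re_mul_ofReal, Complex.sub_re, Complex.one_re]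
    calc _ ≤ Real.exp (-M) := Real.exp_le_exp.2 (by nlinarith)
      _ ≤ 1 / √M := by
        rw [Real.exp_neg, one_div]
        refine inv_anti₀ hs0 ?_
        have := Real.add_one_le_exp (M : ℝ)
        nlinarith
  have h2 : ‖binGen M z‖ ≤ 1 / √M := by
    rw [le_div_iff₀ hs0]
    refine abs_le_one_iff_mul_self_le_one.2 ?_ |> le_of_abs_le
    have h3 : |z.re| ≤ Real.exp (-(1 + z.re)) := by
      rw [abs_of_nonpos hre]
      linarith [Real.add_one_le_exp (-(1 + z.re))]
    have h4 : (|z.re| ^ M) ^ 2 ≤ Real.exp (-(2 * M * (1 + z.re))) := by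
      calc _ ≤ (Real.exp (-(1 + z.re)) ^ M) ^ 2 := by gcongr
        _ = _ := by
          rw [← pow_mul, ← Real.exp_nat_mul]
          congr 1
          push_cast
          ring
    have h5 : 2 * M * (1 + z.re) * Real.exp (-(2 * M * (1 + z.re))) ≤ 1 := by
      rw [Real.exp_neg, ← div_eq_mul_inv, div_le_one (Real.exp_pos _)]
      linarith [Real.add_one_le_exp (2 * M * (1 + z.re))]
    have h6 : 0 ≤ (1 + z.re) / 2 * M := by
      have : 0 ≤ 1 + z.re := by linarith
      positivity
    calc _ = (‖(1 + z ^ 2) / 2‖ ^ M) ^ 2 * ‖(1 + z) / 2‖ ^ 2 * √(M : ℝ) ^ 2 := by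
          rw [binGen, norm_mul, norm_pow]
          ring
      _ = (|z.re| ^ M) ^ 2 * ((1 + z.re) / 2 * M) := by
          rw [norm_one_add_sq_div_two hz, norm_one_add_div_two_sq hz, hsq, mul_assoc]
      _ ≤ Real.exp (-(2 * M * (1 + z.re))) * ((1 + z.re) / 2 * M) := by gcongr
      _ ≤ 1 := by linarith
  calc _ ≤ ‖Complex.exp ((z - 1) * L)‖ + ‖binGen M z‖ := norm_sub_le _ _
    _ ≤ 1 / √M + 1 / √M := add_le_add h1 h2
    _ = _ := by ring

lemma mul_exp_neg_sq_div_two_le (t : ℝ) :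
    (9 * t + 64 * t ^ 3) * Real.exp (-(t ^ 2 / 2)) ≤ 600 := by
  have hexpt : 1 + 4 * (t ^ 2 / 2) ^ 2 ≤ 8 * Real.exp (t ^ 2 / 2) := by
    have := Real.quadratic_le_exp_of_nonneg (show 0 ≤ t ^ 2 / 2 by positivity)
    nlinarith [sq_nonneg t]
  rw [Real.exp_neg, ← div_eq_mul_inv, div_le_iff₀ (Real.exp_pos _)]
  have h1 : t ≤ 1 + t ^ 4 := by nlinarith [sq_nonneg (t ^ 2 - 1 / 2), sq_nonneg (t - 1 / 2)]
  have h3 : t ^ 3 ≤ 1 + t ^ 4 := by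
    nlinarith [sq_nonneg (t ^ 2 - t), sq_nonneg (t - 1), sq_nonneg (t ^ 2 - 1)]
  nlinarith [Real.exp_pos (t ^ 2 / 2)]

lemma norm_cexp_sub_binGen_le_of_re_nonneg {z : ℂ} (hz : ‖z‖ = 1) (hre : 0 ≤ z.re) {M : ℕ}
    (hM : 1 ≤ M) {L : ℝ} (hML : M ≤ L) (hLM : L ≤ M + 1) :
    ‖Complex.exp ((z - 1) * L) - binGen M z‖ ≤ 600 / √M := by
  obtain ⟨n, rfl⟩ : ∃ n, M = n + 1 := ⟨M - 1, by omega⟩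
  set T : ℝ := √((n + 1 : ℕ) : ℝ) with hT
  have hT0 : 0 < T := Real.sqrt_pos.2 (by positivity)
  have hT2 : T ^ 2 = n + 1 := by
    rw [hT, Real.sq_sqrt (by positivity)]
    push_cast
    rfl
  set w := z - 1 with hw
  set r := ‖w‖ with hr
  have hr0 : 0 ≤ r := norm_nonneg w
  have hr2 : r ≤ 2 := by
    refine (norm_sub_le z 1).trans ?_
    rw [hz, norm_one]
    norm_num
  have hc : z.re - 1 = -(r ^ 2 / 2) := by
    linarith [one_sub_re_eq_norm_sq hz]
  have he2 : Real.exp 2 ≤ 8 := by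
    have h := Real.exp_one_lt_d9
    have : Real.exp 2 = Real.exp 1 ^ 2 := by rw [← Real.exp_nat_mul]; norm_num
    rw [this]
    nlinarith [Real.exp_pos 1]
  set R := Real.exp (z.re - 1) with hR
  set a := Complex.exp w with ha
  set b := (1 + z ^ 2) / 2 with hb
  have hnorma : ‖a‖ = R := by
    rw [ha, Complex.norm_exp, hw, Complex.sub_re, Complex.one_re]
  have hnormb : ‖b‖ ≤ R := by
    rw [hb, norm_one_add_sq_div_two hz, abs_of_nonneg hre]
    linarith [Real.add_one_le_exp (z.re - 1)]
  have hab : ‖a - b‖ ≤ 8 * r ^ 3 := by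
    have h := Complex.norm_exp_sub_sum_le_norm_mul_exp w 3
    have h1 : ∑ m ∈ range 3, w ^ m / (m.factorial : ℂ) = b := by
      simp only [sum_range_succ, range_zero, sum_empty, Nat.factorial, hb, hw]
      push_cast
      ring
    rw [h1] at h
    calc _ ≤ r ^ 3 * Real.exp r := h
      _ ≤ r ^ 3 * Real.exp 2 := by gcongr
      _ ≤ _ := by nlinarith [pow_nonneg hr0 3]
  have hE : ‖Complex.exp (w * (L - (n + 1 : ℕ) : ℝ)) - 1‖ ≤ 8 * r := by
    have h := Complex.norm_exp_sub_sum_le_norm_mul_exp (w * (L - (n + 1 : ℕ) : ℝ)) 1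
    simp only [range_one, sum_singleton, pow_zero, Nat.factorial_zero, Nat.cast_one, div_one,
      pow_one] at h
    have h1 : ‖w * (L - (n + 1 : ℕ) : ℝ)‖ ≤ r := by
      rw [norm_mul, Complex.norm_real, Real.norm_of_nonneg (by linarith)]
      exact mul_le_of_le_one_right hr0 (by linarith)
    calc _ ≤ ‖w * (L - (n + 1 : ℕ) : ℝ)‖ * Real.exp ‖w * (L - (n + 1 : ℕ) : ℝ)‖ := h
      _ ≤ r * Real.exp 2 := by gcongr; linarith
      _ ≤ _ := by nlinarith
  have hexp : Complex.exp (w * L) = a ^ (n + 1) * Complex.exp (w * (L - (n + 1 : ℕ) : ℝ)) := by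
    rw [ha, ← Complex.exp_nat_mul, ← Complex.exp_add]
    congr 1
    push_cast
    ring
  have hpow : R ^ n ≤ 8 * R ^ (n + 1) := by
    have h1 : 1 ≤ 8 * R := by
      have h2 : Real.exp (-2) ≤ R := Real.exp_le_exp.2 (by nlinarith)
      have h3 : Real.exp (-2) * Real.exp 2 = 1 := by rw [← Real.exp_add]; simp
      nlinarith [Real.exp_pos (-2)]
    have h2 : 0 ≤ R ^ n := by positivity
    rw [pow_succ]
    nlinarith
  have hRn : R ^ (n + 1) = Real.exp (-((T * r) ^ 2 / 2)) := by
    rw [hR, ← Real.exp_nat_mul, hc, mul_pow, hT2]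
    congr 1
    push_cast
    ring
  have hh : ‖(1 + z) / 2‖ ≤ 1 := by
    rw [norm_div]
    have := norm_add_le 1 z
    rw [hz, norm_one] at this
    norm_num
    linarith
  have hh' : ‖1 - (1 + z) / 2‖ ≤ r := by
    rw [show 1 - (1 + z) / 2 = -w / 2 by rw [hw]; ring, norm_div, norm_neg]
    norm_num
    linarith
  have hRpos : 0 < R ^ (n + 1) := by positivity
  have hbound : ‖Complex.exp (w * L) - binGen (n + 1) z‖ ≤
      R ^ (n + 1) * (9 * r + 64 * (n + 1) * r ^ 3) := by
    calc _ = ‖a ^ (n + 1) * (Complex.exp (w * (L - (n + 1 : ℕ) : ℝ)) - 1) +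
          (a ^ (n + 1) * (1 - (1 + z) / 2) + (a ^ (n + 1) - b ^ (n + 1)) * ((1 + z) / 2))‖ := by
          rw [hexp, binGen]
          congr 1
          ring
      _ ≤ R ^ (n + 1) * (8 * r) + (R ^ (n + 1) * r + (n + 1) * (8 * r ^ 3) * (8 * R ^ (n + 1)) * 1) := by
          refine (norm_add_le _ _).trans (add_le_add ?_ ((norm_add_le _ _).trans (add_le_add ?_ ?_)))
          · rw [norm_mul, norm_pow, hnorma]
            gcongr
          · rw [norm_mul, norm_pow, hnorma]
            gcongr
          · rw [norm_mul]
            gcongr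
            refine (norm_pow_succ_sub_pow_succ_le hnorma.le hnormb n).trans ?_
            gcongr
      _ = _ := by ring
  refine hbound.trans ?_
  rw [le_div_iff₀ hT0]
  calc _ = (9 * (T * r) + 64 * (T * r) ^ 3) * Real.exp (-((T * r) ^ 2 / 2)) := by
        rw [← hRn]
        linear_combination (-64 * R ^ (n + 1) * r ^ 3 * T) * hT2
    _ ≤ 600 := mul_exp_neg_sq_div_two_le _

lemma norm_cexp_sub_binGen_le {z : ℂ} (hz : ‖z‖ = 1) {M : ℕ} (hM : 1 ≤ M) {L : ℝ} (hML : M ≤ L)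
    (hLM : L ≤ M + 1) : ‖Complex.exp ((z - 1) * L) - binGen M z‖ ≤ 600 / √M := by
  rcases le_total 0 z.re with h | h
  · exact norm_cexp_sub_binGen_le_of_re_nonneg hz h hM hML hLM
  · exact (norm_cexp_sub_binGen_le_of_re_nonpos hz h hM hML).trans (by gcongr; norm_num)

section SquareMean
open Topology MeasureTheory

lemma continuous_omegaMean_left (v : ℝ) : Continuous fun z => omegaMean z v := by
  unfold omegaMean
  refine (continuous_finsetSum _ fun n hn => ?_).mul continuous_const
  have : n ≠ 0 := (mem_Ioc.1 hn).1.ne'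
  simp only [powOmega_apply this]
  fun_prop

lemma continuous_binGen (M : ℕ) : Continuous (binGen M) := by
  unfold binGen
  fun_prop

lemma integral_exp_cos_sub_one_le {L : ℝ} (hL : 0 < L) :
    ∫ θ in -Real.pi..Real.pi, Real.exp (2 * L * (Real.cos θ - 1)) ≤ 4 / √L := by
  have hπ := Real.pi_pos
  set b := 4 / Real.pi ^ 2 * L with hb
  have hb0 : 0 < b := by positivity
  calc _ ≤ ∫ θ in -Real.pi..Real.pi, Real.exp (-b * θ ^ 2) := by
        refine intervalIntegral.integral_mono_on (by linarith)
          (Continuous.intervalIntegrable (by fun_prop) _ _)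
          (Continuous.intervalIntegrable (by fun_prop) _ _) fun θ hθ => ?_
        refine Real.exp_le_exp.2 ?_
        have h := Real.cos_le_one_sub_mul_cos_sq (abs_le.2 hθ)
        have h2 : 2 * L * (Real.cos θ - 1) ≤ 2 * L * (-(2 / Real.pi ^ 2 * θ ^ 2)) := by
          gcongr
          linarith
        refine h2.trans (le_of_eq ?_)
        rw [hb]
        ring
    _ ≤ ∫ θ, Real.exp (-b * θ ^ 2) := by
        rw [intervalIntegral.integral_of_le (by linarith)]
        exact setIntegral_le_integral (integrable_exp_neg_mul_sq hb0)
          (Eventually.of_forall fun _ => (Real.exp_pos _).le)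
    _ = √(Real.pi / b) := integral_gaussian b
    _ ≤ 4 / √L := by
        rw [← Real.sqrt_sq (show (0 : ℝ) ≤ 4 by norm_num), ← Real.sqrt_div (by norm_num)]
        refine Real.sqrt_le_sqrt ?_
        rw [hb, div_mul_eq_mul_div, div_div_eq_mul_div, div_le_div_iff₀ (by positivity) hL]
        have h4 := Real.pi_lt_four
        have : Real.pi * Real.pi ^ 2 ≤ 4 * 4 ^ 2 := by gcongr
        nlinarith

/-- Mean square distance on the unit circle between the generating function of `Ω(n)`, `n ≤ e ^ v`,
and that of the weights of `e2bin` at scale `⌊log v⌋`. -/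
lemma eventually_integral_omegaMean_sub_binGen_sq_le {ε : ℝ} (hε : 0 < ε) : ∀ᶠ v : ℝ in atTop,
    ∫ θ in -Real.pi..Real.pi, ‖omegaMean (Complex.exp (θ * Complex.I)) v -
      binGen ⌊Real.log v⌋₊ (Complex.exp (θ * Complex.I))‖ ^ 2 ≤ ε / √(⌊Real.log v⌋₊ : ℝ) := by
  obtain ⟨κ, hκ, K, hK, hmean⟩ := exists_norm_omegaMean_sub_cexp_le (η := √(ε / 48)) (by positivity)
  have hlim1 : Tendsto (fun L : ℝ => 24 * K ^ 2 * 4 * (L ^ (1 / 2 : ℝ) * Real.exp (-(2 * κ) * L)))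
      atTop (𝓝 (24 * K ^ 2 * 4 * 0)) :=
    (tendsto_rpow_mul_exp_neg_mul_atTop_nhds_zero _ _ (by positivity)).const_mul _
  rw [mul_zero] at hlim1
  have hlim2 : Tendsto (fun M : ℕ => 3 * 600 ^ 2 * 8 / √(M : ℝ)) atTop (𝓝 0) :=
    (Real.tendsto_sqrt_atTop.comp tendsto_natCast_atTop_atTop).const_div_atTop _
  filter_upwards [eventually_ge_atTop (Real.exp 1),
    Real.tendsto_log_atTop.eventually (hlim1.eventually_le_const (show 0 < ε / 2 by positivity)),
    (tendsto_nat_floor_atTop.comp Real.tendsto_log_atTop).eventually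
      (hlim2.eventually_le_const (show 0 < ε / 4 by positivity))] with v hv h1 h2
  simp only [Function.comp_apply] at h2
  have hv0 : 0 < v := (Real.exp_pos 1).trans_le hv
  have hv1 : 1 ≤ v := (Real.one_le_exp zero_le_one).trans hv
  set L := Real.log v with hLdef
  have hL1 : 1 ≤ L := by rwa [hLdef, Real.le_log_iff_exp_le hv0]
  have hL0 : 0 < L := by linarith
  set M := ⌊L⌋₊ with hMdef
  have hM1 : 1 ≤ M := by rwa [hMdef, Nat.one_le_floor_iff]
  have hML : (M : ℝ) ≤ L := Nat.floor_le hL0.le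
  have hLM : L ≤ M + 1 := (Nat.lt_floor_add_one L).le
  have hM0 : 0 < √(M : ℝ) := Real.sqrt_pos.2 (by exact_mod_cast hM1)
  have hsM : √(M : ℝ) ^ 2 = M := Real.sq_sqrt (Nat.cast_nonneg _)
  have hMsL : √(M : ℝ) ≤ √L := Real.sqrt_le_sqrt hML
  have hπ := Real.pi_pos
  have hπ4 := Real.pi_lt_four
  have hpt : ∀ θ : ℝ, ‖omegaMean (Complex.exp (θ * Complex.I)) v -
      binGen M (Complex.exp (θ * Complex.I))‖ ^ 2 ≤
      3 * (ε / 48) * Real.exp (2 * L * (Real.cos θ - 1)) +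
        (3 * K ^ 2 * Real.exp (-(2 * κ) * L) + 3 * 600 ^ 2 / M) := by
    intro θ
    set z := Complex.exp (θ * Complex.I) with hz
    have hz1 : ‖z‖ = 1 := Complex.norm_exp_ofReal_mul_I θ
    have hre : z.re = Real.cos θ := Complex.exp_ofReal_mul_I_re θ
    have e1 := hmean v hv1 z hz1
    have e2 := norm_cexp_sub_binGen_le hz1 hM1 hML hLM
    have e3 := norm_sub_le_norm_sub_add_norm_sub (omegaMean z v) (Complex.exp ((z - 1) * L))
      (binGen M z)
    have e4 : (√(ε / 48) * v ^ (z.re - 1)) ^ 2 = ε / 48 * Real.exp (2 * L * (Real.cos θ - 1)) := by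
      rw [mul_pow, Real.sq_sqrt (by positivity), Real.rpow_def_of_pos hv0, ← Real.exp_nat_mul, hre]
      congr 2
      push_cast
      ring
    have e5 : (K * v ^ (-κ)) ^ 2 = K ^ 2 * Real.exp (-(2 * κ) * L) := by
      rw [mul_pow, Real.rpow_def_of_pos hv0, ← Real.exp_nat_mul]
      congr 2
      push_cast
      ring
    have e6 : (600 / √(M : ℝ)) ^ 2 = 600 ^ 2 / M := by rw [div_pow, hsM]
    set x := √(ε / 48) * v ^ (z.re - 1)
    set y := K * v ^ (-κ)
    set w := 600 / √(M : ℝ)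
    calc _ ≤ (x + y + w) ^ 2 := by
          gcongr
          linarith
      _ ≤ 3 * x ^ 2 + (3 * y ^ 2 + 3 * w ^ 2) := by
          nlinarith [sq_nonneg (x - y), sq_nonneg (x - w), sq_nonneg (y - w)]
      _ = _ := by
          rw [e4, e5, e6]
          ring
  have hcont : Continuous fun θ : ℝ => ‖omegaMean (Complex.exp (θ * Complex.I)) v -
      binGen M (Complex.exp (θ * Complex.I))‖ ^ 2 := by
    have hc : Continuous fun θ : ℝ => Complex.exp (θ * Complex.I) := by fun_prop
    exact (((continuous_omegaMean_left v).comp hc).sub ((continuous_binGen M).comp hc)).norm.pow 2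
  have hce : Continuous fun θ : ℝ => 3 * (ε / 48) * Real.exp (2 * L * (Real.cos θ - 1)) := by
    fun_prop
  set D := 3 * K ^ 2 * Real.exp (-(2 * κ) * L) + 3 * 600 ^ 2 / M with hD
  have hD0 : 0 ≤ D := by positivity
  have hDle : 8 * D ≤ 3 / 4 * ε / √(M : ℝ) := by
    rw [le_div_iff₀ hM0]
    have e1 : √(M : ℝ) * Real.exp (-(2 * κ) * L) ≤ L ^ (1 / 2 : ℝ) * Real.exp (-(2 * κ) * L) := by
      rw [← Real.sqrt_eq_rpow]
      gcongr
    have e2 : 3 * 600 ^ 2 / (M : ℝ) * √(M : ℝ) * 8 = 3 * 600 ^ 2 * 8 / √(M : ℝ) := by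
      field_simp
      rw [hsM]
    have e3 : 24 * K ^ 2 * (√(M : ℝ) * Real.exp (-(2 * κ) * L)) ≤
        24 * K ^ 2 * (L ^ (1 / 2 : ℝ) * Real.exp (-(2 * κ) * L)) := by gcongr
    have e4 : 0 ≤ 24 * K ^ 2 * (L ^ (1 / 2 : ℝ) * Real.exp (-(2 * κ) * L)) := by positivity
    rw [hD]
    nlinarith
  calc _ ≤ ∫ θ in -Real.pi..Real.pi,
        (3 * (ε / 48) * Real.exp (2 * L * (Real.cos θ - 1)) + D) :=
        intervalIntegral.integral_mono_on (by linarith) (hcont.intervalIntegrable _ _)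
          ((hce.add continuous_const).intervalIntegrable _ _) fun θ _ => hpt θ
    _ = 3 * (ε / 48) * (∫ θ in -Real.pi..Real.pi, Real.exp (2 * L * (Real.cos θ - 1))) +
          2 * Real.pi * D := by
        rw [intervalIntegral.integral_add (hce.intervalIntegrable _ _)
          (continuous_const.intervalIntegrable _ _), intervalIntegral.integral_const_mul,
          intervalIntegral.integral_const, smul_eq_mul]
        ring
    _ ≤ 3 * (ε / 48) * (4 / √(M : ℝ)) + 3 / 4 * ε / √(M : ℝ) := by
        refine add_le_add ?_ ?_
        · gcongr
          refine (integral_exp_cos_sub_one_le hL0).trans ?_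
          gcongr
        · nlinarith
    _ = ε / √(M : ℝ) := by ring

end SquareMean

section Parseval
open MeasureTheory

lemma integral_cexp_int_mul_I (m : ℤ) :
    ∫ θ in -Real.pi..Real.pi, Complex.exp (m * Complex.I * (θ : ℝ)) =
      if m = 0 then 2 * Real.pi else 0 := by
  split_ifs with h
  · subst h
    simp only [Int.cast_zero, zero_mul, Complex.exp_zero, intervalIntegral.integral_const]
    rw [Complex.real_smul]
    push_cast
    ring
  · have h0 : (m : ℂ) * Complex.I ≠ 0 :=
      mul_ne_zero (by exact_mod_cast h) Complex.I_ne_zero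
    rw [integral_exp_mul_complex h0, Complex.ofReal_zero, div_eq_zero_iff, sub_eq_zero]
    left
    rw [Complex.exp_eq_exp_iff_exists_int]
    refine ⟨m, ?_⟩
    push_cast
    ring

lemma integral_norm_sq_sum_mul_pow (c : ℕ → ℝ) (n : ℕ) :
    ∫ θ in -Real.pi..Real.pi, ‖∑ k ∈ range n, (c k : ℂ) * Complex.exp (θ * Complex.I) ^ k‖ ^ 2 =
      2 * Real.pi * ∑ k ∈ range n, c k ^ 2 := by
  have hexp : ∀ θ : ℝ, ((‖∑ k ∈ range n, (c k : ℂ) * Complex.exp (θ * Complex.I) ^ k‖ ^ 2 : ℝ) : ℂ) =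
      ∑ j ∈ range n, ∑ k ∈ range n,
        (c j * c k : ℂ) * Complex.exp (((j : ℤ) - k : ℤ) * Complex.I * θ) := by
    intro θ
    rw [Complex.ofReal_pow, ← Complex.mul_conj', map_sum, sum_mul_sum]
    refine sum_congr rfl fun j _ => sum_congr rfl fun k _ => ?_
    rw [map_mul, map_pow, Complex.conj_ofReal, ← Complex.exp_conj, map_mul, Complex.conj_ofReal,
      Complex.conj_I, ← Complex.exp_nat_mul, ← Complex.exp_nat_mul,
      show ((((j : ℤ) - k : ℤ) : ℂ) * Complex.I * θ) =
        (j : ℂ) * (θ * Complex.I) + k * (θ * -Complex.I) by push_cast; ring, Complex.exp_add]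
    ring
  rw [← Complex.ofReal_inj, ← intervalIntegral.integral_ofReal]
  simp only [hexp]
  have hint : ∀ j k : ℕ, IntervalIntegrable (fun θ : ℝ =>
      (c j * c k : ℂ) * Complex.exp (((j : ℤ) - k : ℤ) * Complex.I * θ)) volume
      (-Real.pi) Real.pi := fun j k => Continuous.intervalIntegrable (by fun_prop) _ _
  rw [intervalIntegral.integral_finsetSum fun j _ =>
    Continuous.intervalIntegrable (by fun_prop) _ _]
  rw [Complex.ofReal_mul, Complex.ofReal_sum, mul_sum]
  refine sum_congr rfl fun j hj => ?_
  rw [intervalIntegral.integral_finsetSum fun k _ => hint j k]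
  simp only [intervalIntegral.integral_const_mul, integral_cexp_int_mul_I]
  rw [sum_eq_single j]
  · simp
    ring
  · intro k _ hk
    rw [if_neg, Complex.ofReal_zero, mul_zero]
    omega
  · exact fun h => absurd hj h

end Parseval

/-- Proportion of the integers `n ≤ N` with `Ω(n) = k`. -/
noncomputable def omegaFreq (N k : ℕ) : ℝ := (#{n ∈ Icc 1 N | bigOmega n = k} : ℝ) / N

/-- The weights of `e2bin`. -/
noncomputable def binWeight (M k : ℕ) : ℝ := (M.choose (k / 2) : ℝ) / 2 ^ (M + 1)

lemma omegaFreq_nonneg (N k : ℕ) : 0 ≤ omegaFreq N k := by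
  unfold omegaFreq
  positivity

lemma binWeight_nonneg (M k : ℕ) : 0 ≤ binWeight M k := by
  unfold binWeight
  positivity

lemma binWeight_eq_zero {M k : ℕ} (h : 2 * M + 2 ≤ k) : binWeight M k = 0 := by
  rw [binWeight, Nat.choose_eq_zero_of_lt (by omega), Nat.cast_zero, zero_div]

lemma cesaro_eq_sum_omegaFreq (f : ℕ → ℂ) {N K : ℕ} (hK : ∀ n ∈ Icc 1 N, bigOmega n < K) :
    cesaro (fun n => f (bigOmega n)) N = ∑ k ∈ range K, (omegaFreq N k : ℂ) * f k := by
  rw [cesaro, ← sum_fiberwise_of_maps_to (g := bigOmega) (fun n hn => mem_range.2 (hK n hn)),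
    mul_sum]
  refine sum_congr rfl fun k _ => ?_
  rw [sum_congr rfl (g := fun _ => f k) fun n hn => by rw [(mem_filter.1 hn).2], sum_const,
    omegaFreq, nsmul_eq_mul]
  push_cast
  ring

lemma omegaMean_log_natCast (z : ℂ) {N : ℕ} (hN : N ≠ 0) :
    omegaMean z (Real.log N) = cesaro (fun n => z ^ bigOmega n) N := by
  have h0 : (0 : ℝ) < N := by exact_mod_cast Nat.pos_of_ne_zero hN
  rw [omegaMean, cesaro, Real.exp_neg, Real.exp_log h0, Nat.floor_natCast, mul_comm]
  push_cast
  rw [one_div]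
  congr 1
  refine sum_congr rfl fun n hn => ?_
  rw [powOmega_apply (mem_Ioc.1 hn).1.ne', bigOmega, ArithmeticFunction.cardFactors_apply]

lemma sum_omegaFreq {N K : ℕ} (hN : N ≠ 0) (hK : ∀ n ∈ Icc 1 N, bigOmega n < K) :
    ∑ k ∈ range K, omegaFreq N k = 1 := by
  have h := cesaro_eq_sum_omegaFreq (fun _ => 1) hK
  have h0 : (N : ℂ) ≠ 0 := by exact_mod_cast hN
  simp only [cesaro, sum_const, Nat.card_Icc, Nat.add_sub_cancel, nsmul_eq_mul, mul_one] at h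
  rw [one_div, inv_mul_cancel₀ h0] at h
  exact_mod_cast h.symm

lemma sum_range_two_mul {E : Type*} [AddCommMonoid E] (g : ℕ → E) (n : ℕ) :
    ∑ k ∈ range (2 * n), g k = ∑ j ∈ range n, (g (2 * j) + g (2 * j + 1)) := by
  induction n with
  | zero => simp
  | succ n ih => rw [mul_add, mul_one, sum_range_succ, sum_range_succ, ih, sum_range_succ, add_assoc]

lemma binGen_eq_sum {M K : ℕ} (hK : 2 * M + 2 ≤ K) (z : ℂ) :
    binGen M z = ∑ k ∈ range K, (binWeight M k : ℂ) * z ^ k := by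
  rw [← sum_subset (range_mono hK) (fun k _ hk => by
    rw [binWeight_eq_zero (by simpa using hk)]; simp), ← mul_add_one, sum_range_two_mul, binGen,
    div_pow, add_comm 1 (z ^ 2), add_pow, sum_div, sum_mul]
  refine sum_congr rfl fun j _ => ?_
  have h1 : 2 * j / 2 = j := by omega
  have h2 : (2 * j + 1) / 2 = j := by omega
  rw [binWeight, binWeight, h1, h2]
  push_cast
  rw [one_pow, pow_succ (2 : ℂ)]
  field_simp
  ring

lemma sum_binWeight {M K : ℕ} (hK : 2 * M + 2 ≤ K) : ∑ k ∈ range K, binWeight M k = 1 := by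
  have h := binGen_eq_sum hK 1
  norm_num [binGen] at h
  exact_mod_cast h.symm

lemma sum_choose_mul_sq (M : ℕ) :
    ∑ j ∈ range (M + 1), (M.choose j : ℝ) * (2 * j - M) ^ 2 = (M : ℝ) * 2 ^ M := by
  have h := congr_arg (Polynomial.eval (1 / 2 : ℝ)) (bernsteinPolynomial.variance ℝ M)
  simp only [bernsteinPolynomial, Polynomial.eval_finsetSum, Polynomial.eval_mul,
    Polynomial.eval_pow, Polynomial.eval_sub, Polynomial.eval_X, Polynomial.eval_one,
    Polynomial.eval_natCast, nsmul_eq_mul] at h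
  have h2 : ∑ j ∈ range (M + 1), (M.choose j : ℝ) * (2 * j - M) ^ 2 =
      4 * 2 ^ M * ∑ j ∈ range (M + 1), ((M : ℝ) * (1 / 2) - j) ^ 2 *
        (M.choose j * (1 / 2) ^ j * (1 - 1 / 2) ^ (M - j)) := by
    rw [mul_sum]
    refine sum_congr rfl fun j hj => ?_
    have h3 : (1 / 2 : ℝ) ^ j * (1 - 1 / 2) ^ (M - j) = (2 ^ M)⁻¹ := by
      rw [show (1 - 1 / 2 : ℝ) = 1 / 2 by norm_num, ← pow_add,
        Nat.add_sub_cancel' (Nat.lt_succ_iff.1 (mem_range.1 hj)), one_div, inv_pow]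
    rw [mul_assoc (M.choose j : ℝ), h3]
    field_simp
    ring
  rw [h2, h]
  ring

lemma sum_binWeight_mul_sq_le {M K : ℕ} (hM : 1 ≤ M) (hK : 2 * M + 2 ≤ K) :
    ∑ k ∈ range K, binWeight M k * ((k : ℝ) - M) ^ 2 ≤ 4 * (M : ℝ) := by
  have hM1 : (1 : ℝ) ≤ M := by exact_mod_cast hM
  rw [← sum_subset (range_mono hK) (fun k _ hk => by
    rw [binWeight_eq_zero (by simpa using hk), zero_mul]), ← mul_add_one, sum_range_two_mul]
  calc _ ≤ ∑ j ∈ range (M + 1),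
        (3 / 2 * ((M.choose j : ℝ) * (2 * j - M) ^ 2) / 2 ^ M +
          (M.choose j : ℝ) / 2 ^ M) := by
        refine sum_le_sum fun j _ => ?_
        have h1 : 2 * j / 2 = j := by omega
        have h2 : (2 * j + 1) / 2 = j := by omega
        rw [binWeight, binWeight, h1, h2]
        push_cast
        have h3 : (0 : ℝ) ≤ M.choose j / 2 ^ (M + 1) := by positivity
        have h4 : (M.choose j : ℝ) / 2 ^ M = 2 * (M.choose j / 2 ^ (M + 1)) := by
          rw [pow_succ]
          field_simp
        rw [mul_comm (M.choose j : ℝ), ← mul_assoc, mul_div_assoc, h4, ← mul_add]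
        nlinarith [mul_nonneg h3 (sq_nonneg (2 * (j : ℝ) - M - 1))]
    _ = 3 / 2 * ((M : ℝ) * 2 ^ M) / 2 ^ M + 1 := by
        rw [sum_add_distrib, ← sum_div, ← sum_div, ← mul_sum, sum_choose_mul_sq]
        congr 1
        have := Nat.sum_range_choose M
        rw [div_eq_one_iff_eq (by positivity)]
        exact_mod_cast this
    _ ≤ _ := by
        rw [← mul_assoc, mul_div_cancel_right₀ _ (by positivity)]
        linarith

lemma norm_e2bin_sub_le {f : ℕ → ℂ} (hf : ∀ n, ‖f n‖ ≤ 1) {M K : ℕ} (hK : 2 * M + 2 ≤ K) :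
    ‖∑ k ∈ range K, (binWeight M k : ℂ) * f k - e2bin f M‖ ≤ (1 / 2) ^ M := by
  have h : e2bin f M = ∑ k ∈ Icc 1 (2 * M), (binWeight M k : ℂ) * f k := by
    rw [e2bin, mul_sum]
    refine sum_congr rfl fun k _ => ?_
    rw [binWeight]
    push_cast
    ring
  have h2 : range (2 * M + 1) = insert 0 (Icc 1 (2 * M)) := by
    ext k
    simp only [mem_range, mem_insert, mem_Icc]
    omega
  rw [← sum_subset (range_mono hK) (fun k _ hk => by
    rw [binWeight_eq_zero (by simpa using hk)]; simp), sum_range_succ, h2,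
    sum_insert (by simp), h]
  have h3 : binWeight M 0 = (1 / 2) ^ (M + 1) := by simp [binWeight]
  have h4 : binWeight M (2 * M + 1) = (1 / 2) ^ (M + 1) := by
    rw [binWeight, show (2 * M + 1) / 2 = M by omega]
    simp
  rw [h3, h4]
  set p : ℝ := (1 / 2) ^ (M + 1) with hp
  have hp0 : 0 ≤ p := by positivity
  calc _ = ‖(p : ℂ) * f 0 + p * f (2 * M + 1)‖ := by
        congr 1
        ring
    _ ≤ p * 1 + p * 1 := by
        refine (norm_add_le _ _).trans ?_
        rw [norm_mul, norm_mul, Complex.norm_real, Real.norm_of_nonneg hp0]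
        gcongr <;> exact hf _
    _ = _ := by
        rw [hp, pow_succ]
        ring

/-- An `ℓ¹` bound for two probability vectors, from an `ℓ²` bound on a window around `M` and the
second moment of one of them. -/
lemma sum_abs_sub_le_of_sum_sq_le {p q : ℕ → ℝ} {K M T : ℕ} {V A : ℝ} (hT : 1 ≤ T)
    (hp : ∀ k, 0 ≤ p k) (hq : ∀ k, 0 ≤ q k)
    (hpq : ∑ k ∈ range K, p k = ∑ k ∈ range K, q k)
    (hV : ∑ k ∈ range K, q k * ((k : ℝ) - M) ^ 2 ≤ V)
    (hA : ∑ k ∈ range K, (p k - q k) ^ 2 ≤ A) :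
    ∑ k ∈ range K, |p k - q k| ≤ 2 * √((2 * T + 1) * A) + 2 * (V / T ^ 2) := by
  have hT0 : (0 : ℝ) < T := by exact_mod_cast hT
  set I := {k ∈ range K | k ∈ Icc (M - T) (M + T)} with hI
  set J := {k ∈ range K | k ∉ Icc (M - T) (M + T)} with hJ
  have hsplit : ∀ g : ℕ → ℝ, ∑ k ∈ range K, g k = ∑ k ∈ I, g k + ∑ k ∈ J, g k := fun g =>
    (sum_filter_add_sum_filter_not _ _ _).symm
  have hIle : ∑ k ∈ I, |p k - q k| ≤ √((2 * T + 1) * A) := by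
    refine Real.le_sqrt_of_sq_le ?_
    have h1 := sq_sum_le_card_mul_sum_sq (s := I) (f := fun k => |p k - q k|)
    have h2 : (#I : ℝ) ≤ 2 * T + 1 := by
      have : #I ≤ #(Icc (M - T) (M + T)) := card_le_card fun k hk => (mem_filter.1 hk).2
      rw [Nat.card_Icc] at this
      exact_mod_cast this.trans (by omega)
    have h3 : ∑ k ∈ I, |p k - q k| ^ 2 ≤ A := by
      simp only [sq_abs]
      exact (sum_le_sum_of_subset_of_nonneg (filter_subset _ _) fun _ _ _ => sq_nonneg _).trans hA
    calc _ ≤ (#I : ℝ) * ∑ k ∈ I, |p k - q k| ^ 2 := h1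
      _ ≤ _ := by gcongr
  have hJle : ∑ k ∈ J, q k ≤ V / T ^ 2 := by
    rw [le_div_iff₀ (by positivity), sum_mul]
    refine le_trans ?_ hV
    refine (sum_le_sum fun k hk => ?_).trans
      (sum_le_sum_of_subset_of_nonneg (filter_subset _ _) fun k _ _ =>
        mul_nonneg (hq k) (sq_nonneg _))
    refine mul_le_mul_of_nonneg_left ?_ (hq k)
    have h1 := (mem_filter.1 hk).2
    rw [mem_Icc] at h1
    rcases lt_or_ge (M + T) k with h | h
    · have : (M : ℝ) + T < k := by exact_mod_cast h
      nlinarith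
    · have h2 : k + T < M := by omega
      have : (k : ℝ) + T < M := by exact_mod_cast h2
      nlinarith
  have hJabs : ∑ k ∈ J, |p k - q k| ≤ ∑ k ∈ J, p k + ∑ k ∈ J, q k := by
    rw [← sum_add_distrib]
    refine sum_le_sum fun k _ => ?_
    rw [abs_le]
    constructor <;> linarith [hp k, hq k]
  have hpJ : ∑ k ∈ J, p k ≤ ∑ k ∈ J, q k + ∑ k ∈ I, |p k - q k| := by
    have h1 : ∑ k ∈ I, (q k - p k) ≤ ∑ k ∈ I, |p k - q k| :=
      sum_le_sum fun k _ => by rw [abs_sub_comm]; exact le_abs_self _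
    rw [sum_sub_distrib] at h1
    linarith [hsplit p, hsplit q]
  rw [hsplit]
  linarith

lemma sum_sq_omegaFreq_sub_binWeight {N M K : ℕ} (hN : N ≠ 0) (hK : 2 * M + 2 ≤ K)
    (hNK : ∀ n ∈ Icc 1 N, bigOmega n < K) :
    2 * Real.pi * ∑ k ∈ range K, (omegaFreq N k - binWeight M k) ^ 2 =
      ∫ θ in -Real.pi..Real.pi, ‖omegaMean (Complex.exp (θ * Complex.I)) (Real.log N) -
        binGen M (Complex.exp (θ * Complex.I))‖ ^ 2 := by
  rw [← integral_norm_sq_sum_mul_pow]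
  refine intervalIntegral.integral_congr fun θ _ => ?_
  rw [omegaMean_log_natCast _ hN, cesaro_eq_sum_omegaFreq _ hNK, binGen_eq_sum hK,
    ← sum_sub_distrib]
  congr 2
  refine sum_congr rfl fun k _ => ?_
  push_cast
  ring

/-- The law of `Ω(n)`, `n ≤ N`, is close in total variation to the weights of `e2bin`. -/
lemma eventually_sum_abs_omegaFreq_sub_binWeight_le {ε : ℝ} (hε : 0 < ε) : ∀ᶠ N : ℕ in atTop,
    ∀ K : ℕ, 2 * ⌊Real.log (Real.log N)⌋₊ + 2 ≤ K → (∀ n ∈ Icc 1 N, bigOmega n < K) →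
    ∑ k ∈ range K, |omegaFreq N k - binWeight ⌊Real.log (Real.log N)⌋₊ k| ≤ ε := by
  obtain ⟨R, hR⟩ := exists_nat_gt (4 / √ε)
  have hR0 : (0 : ℝ) < R := lt_trans (by positivity) hR
  have hR1 : 1 ≤ R := by exact_mod_cast hR0
  have hR2 : 2 * (4 / (R : ℝ) ^ 2) ≤ ε / 2 := by
    rw [div_lt_iff₀ (Real.sqrt_pos.2 hε)] at hR
    have h1 : 4 ^ 2 ≤ (R * √ε) ^ 2 := by gcongr
    rw [mul_pow, Real.sq_sqrt hε.le] at h1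
    rw [← mul_div_assoc, div_le_iff₀ (by positivity)]
    linarith
  set δ := ε ^ 2 / (16 * (2 * R + 3)) with hδ
  have hlog : Tendsto (fun N : ℕ => Real.log N) atTop atTop :=
    Real.tendsto_log_atTop.comp tendsto_natCast_atTop_atTop
  filter_upwards [hlog.eventually
      (eventually_integral_omegaMean_sub_binGen_sq_le (show 0 < δ by positivity)),
    (Real.tendsto_log_atTop.comp hlog).eventually (eventually_ge_atTop 1),
    eventually_ne_atTop 0] with N hint hL hN K hK hNK
  simp only [Function.comp_apply] at hL
  set M := ⌊Real.log (Real.log N)⌋₊ with hM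
  have hM1 : 1 ≤ M := by rwa [hM, Nat.one_le_floor_iff]
  have hM1' : (1 : ℝ) ≤ M := by exact_mod_cast hM1
  have hsM1 : 1 ≤ √(M : ℝ) := Real.one_le_sqrt.2 hM1'
  have hsM : √(M : ℝ) ^ 2 = M := Real.sq_sqrt (by linarith)
  set T := ⌈R * √(M : ℝ)⌉₊ with hTdef
  have hT1 : R * √(M : ℝ) ≤ T := Nat.le_ceil _
  have hT2 : (T : ℝ) ≤ R * √(M : ℝ) + 1 := (Nat.ceil_lt_add_one (by positivity)).le
  have hT : 1 ≤ T := Nat.one_le_ceil_iff.2 (by positivity)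
  have hsq : ∑ k ∈ range K, (omegaFreq N k - binWeight M k) ^ 2 ≤ δ / √(M : ℝ) := by
    rw [← sum_sq_omegaFreq_sub_binWeight hN hK hNK] at hint
    have h1 : 0 ≤ ∑ k ∈ range K, (omegaFreq N k - binWeight M k) ^ 2 :=
      sum_nonneg fun _ _ => sq_nonneg _
    nlinarith [Real.pi_gt_three]
  refine (sum_abs_sub_le_of_sum_sq_le hT (omegaFreq_nonneg N) (binWeight_nonneg M)
    ((sum_omegaFreq hN hNK).trans (sum_binWeight hK).symm) (sum_binWeight_mul_sq_le hM1 hK)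
    hsq).trans ?_
  have h1 : √((2 * T + 1) * (δ / √(M : ℝ))) ≤ ε / 4 := by
    refine Real.sqrt_le_iff.2 ⟨by positivity, ?_⟩
    have h2 : 2 * (T : ℝ) + 1 ≤ (2 * R + 3) * √(M : ℝ) := by linarith
    calc _ ≤ ((2 * R + 3) * √(M : ℝ)) * (δ / √(M : ℝ)) := by gcongr
      _ = (ε / 4) ^ 2 := by
        rw [hδ]
        field_simp
        ring
  have h2 : 4 * (M : ℝ) / T ^ 2 ≤ 4 / R ^ 2 := by
    rw [div_le_div_iff₀ (by positivity) (by positivity)]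
    have : (R * √(M : ℝ)) ^ 2 ≤ (T : ℝ) ^ 2 := by gcongr
    rw [mul_pow, hsM] at this
    linarith
  linarith

/-- Cesàro averages of `f(Ω(n))` agree with parity-neutral binomial means
of `f` at scale `⌊log log N⌋`, uniformly over `f` with `‖f‖_∞ ≤ 1`. -/
theorem stmt3 :
    ∀ ε : ℝ, 0 < ε → ∀ᶠ N : ℕ in atTop, ∀ f : ℕ → ℂ, (∀ n, ‖f n‖ ≤ 1) →
      ‖cesaro (fun n => f (bigOmega n)) N -
        e2bin f ⌊Real.log (Real.log N)⌋₊‖ < ε := by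
  intro ε hε
  have hfloor : Tendsto (fun N : ℕ => ⌊Real.log (Real.log N)⌋₊) atTop atTop :=
    tendsto_nat_floor_atTop.comp (Real.tendsto_log_atTop.comp
      (Real.tendsto_log_atTop.comp tendsto_natCast_atTop_atTop))
  have hpow := (tendsto_pow_atTop_nhds_zero_of_lt_one (r := (1 / 2 : ℝ)) (by norm_num)
    (by norm_num)).comp hfloor
  filter_upwards [eventually_sum_abs_omegaFreq_sub_binWeight_le (show 0 < ε / 2 by positivity),
    hpow.eventually_lt_const (show 0 < ε / 2 by positivity)] with N h1 h2 f hf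
  simp only [Function.comp_apply] at h2
  set M := ⌊Real.log (Real.log N)⌋₊
  set K := (Icc 1 N).sup bigOmega + (2 * M + 2) with hKdef
  have hK : 2 * M + 2 ≤ K := by omega
  have hNK : ∀ n ∈ Icc 1 N, bigOmega n < K := fun n hn => by
    have := le_sup (f := bigOmega) hn
    omega
  have h3 : ‖cesaro (fun n => f (bigOmega n)) N - ∑ k ∈ range K, (binWeight M k : ℂ) * f k‖ ≤
      ε / 2 := by
    rw [cesaro_eq_sum_omegaFreq f hNK, ← sum_sub_distrib]
    refine (norm_sum_le_of_le _ fun k _ => ?_).trans (h1 K hK hNK)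
    rw [← sub_mul, norm_mul, ← Complex.ofReal_sub, Complex.norm_real, Real.norm_eq_abs]
    exact mul_le_of_le_one_right (abs_nonneg _) (hf k)
  calc _ ≤ _ := norm_sub_le_norm_sub_add_norm_sub _
        (∑ k ∈ range K, (binWeight M k : ℂ) * f k) _
    _ < ε / 2 + ε / 2 := add_lt_add_of_le_of_lt h3 ((norm_e2bin_sub_le hf hK).trans_lt h2)
    _ = ε := add_halves ε
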